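/- arXiv:1807.07198 — 3 statements merged into one kernel-verified Lean document; each statement's English description precedes it below -/
import Mathlib

section
/- Let W_S be a Coxeter group of type D_m, and let X ⊆ S be such that W_X is of type D_n with n odd and n < m. Then the pair (W_X, W_S) satisfies Property ⋆_W. -/
namespace ArtinTits

variable {B : Type*}

/-- The alternating product `a b a b ⋯` with `m` factors, starting with `a`. -/
def altProd {G : Type*} [Monoid G] (a b : G) : ℕ → G
  | 0 => 1
  | n + 1 => a * altProd b a n

/-- The braid relations defining the Artin–Tits group of a Coxeter matrix:
`Π(σ_s, σ_t; m_{s,t}) = Π(σ_t, σ_s; m_{s,t})` whenever `m_{s,t} ≠ ∞` (here `∞` is coded by `0`). -/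
def artinRelationsSet (M : CoxeterMatrix B) : Set (FreeGroup B) :=
  {r | ∃ s t : B, M s t ≠ 0 ∧
    r = altProd (FreeGroup.of s) (FreeGroup.of t) (M s t) *
        (altProd (FreeGroup.of t) (FreeGroup.of s) (M s t))⁻¹}

/-- The Artin–Tits group of a Coxeter matrix. -/
abbrev ArtinGroup (M : CoxeterMatrix B) : Type _ := PresentedGroup (artinRelationsSet M)

/-- The standard generator `σ_s` of the Artin–Tits group. -/
def σ (M : CoxeterMatrix B) (s : B) : ArtinGroup M := PresentedGroup.of s

/-- The standard parabolic subgroup `A_X` of the Artin–Tits group. -/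
def AP (M : CoxeterMatrix B) (X : Set B) : Subgroup (ArtinGroup M) :=
  Subgroup.closure (σ M '' X)

/-- The standard parabolic subgroup `W_X` of the Coxeter group. -/
def WP (M : CoxeterMatrix B) (X : Set B) : Subgroup M.Group :=
  Subgroup.closure (M.simple '' X)

/-- A subgroup `H ≤ G` is conjugacy stable if any two elements of `H` which are conjugate
in `G` are already conjugate by an element of `H`. -/
def IsConjugacyStable {G : Type*} [Group G] (H : Subgroup G) : Prop :=
  ∀ a b : G, a ∈ H → b ∈ H → (∃ g : G, g⁻¹ * a * g = b) → ∃ h ∈ H, h⁻¹ * a * h = b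

/-- Property `⋆_W` for the pair `(W_X, W_S)`. -/
def StarW (M : CoxeterMatrix B) (X : Set B) : Prop :=
  ∀ Y₁ Y₂ : Set B, Y₁ ⊆ X → Y₂ ⊆ X → ∀ w : M.Group,
    (fun x => w⁻¹ * x * w) '' (M.simple '' Y₁) = M.simple '' Y₂ →
    ∃ v ∈ WP M X, ∀ y ∈ Y₁, v⁻¹ * M.simple y * v = w⁻¹ * M.simple y * w

/-- Property `⋆_A` for the pair `(A_X, A_S)`. -/
def StarA (M : CoxeterMatrix B) (X : Set B) : Prop :=
  ∀ Y₁ Y₂ : Set B, Y₁ ⊆ X → Y₂ ⊆ X → ∀ g : ArtinGroup M,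
    (fun x => g⁻¹ * x * g) '' (σ M '' Y₁) = σ M '' Y₂ →
    ∃ h ∈ AP M X, ∀ y ∈ Y₁, h⁻¹ * σ M y * h = g⁻¹ * σ M y * g

/-- Adjacency in the Coxeter graph: `s` and `t` are joined by an edge iff `m_{s,t} ≥ 3`
(where the value `0` codes `∞`, which also gives an edge). -/
def Adj (M : CoxeterMatrix B) (s t : B) : Prop := s ≠ t ∧ M s t ≠ 2

/-- `s` and `t` are connected by a path of the Coxeter graph staying inside `X`. -/
def ReachIn (M : CoxeterMatrix B) (X : Set B) (s t : B) : Prop :=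
  Relation.ReflTransGen (fun a b => a ∈ X ∧ b ∈ X ∧ Adj M a b) s t

/-- The Coxeter graph induced on `X` is connected. -/
def ConnectedIn (M : CoxeterMatrix B) (X : Set B) : Prop :=
  ∀ s ∈ X, ∀ t ∈ X, ReachIn M X s t

/-- The Coxeter matrix `M` restricted to `X` is of the type of the Coxeter matrix `M'`,
i.e. there is a bijection transporting one to the other. -/
def IsOfType {B' : Type*} (M : CoxeterMatrix B) (X : Set B) (M' : CoxeterMatrix B') : Prop :=
  ∃ e : X ≃ B', ∀ a b : X, M a.val b.val = M' (e a) (e b)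

/-- The Coxeter matrix of type `Bₙ` with the paper's labelling: vertices `0, …, n-1`
(representing `s_1, …, s_n`), `m_{s_1, s_2} = 4` and `m_{s_i, s_{i+1}} = 3` for `i ≥ 2`. -/
def Bmat (n : ℕ) : CoxeterMatrix (Fin n) where
  M := Matrix.of fun i j : Fin n ↦
    if i = j then 1
      else (if (i.val = 0 ∧ j.val = 1) ∨ (j.val = 0 ∧ i.val = 1) then 4
        else (if (j : ℕ) + 1 = i ∨ (i : ℕ) + 1 = j then 3 else 2))
  isSymm := by unfold Matrix.IsSymm; aesop
  diagonal := by simp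
  off_diagonal := by aesop

/-- The Coxeter matrix of type `Dₙ` with the paper's labelling: vertices `0, …, n-1`
(representing `s_1, …, s_n`), with edges `{s_1, s_3}`, `{s_2, s_3}` and `{s_i, s_{i+1}}`
for `i ≥ 3`, all labelled `3`. -/
def Dmat (n : ℕ) : CoxeterMatrix (Fin n) where
  M := Matrix.of fun i j : Fin n ↦
    if i = j then 1
      else (if (i.val = 0 ∧ j.val = 2) ∨ (j.val = 0 ∧ i.val = 2) then 3
        else (if i.val = 0 ∨ j.val = 0 then 2
          else (if (j : ℕ) + 1 = i ∨ (i : ℕ) + 1 = j then 3 else 2)))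
  isSymm := by unfold Matrix.IsSymm; aesop
  diagonal := by simp
  off_diagonal := by aesop

end ArtinTits

namespace ArtinTits

/-- The signed transposition of `ℤ` exchanging `a ↔ b` and `-a ↔ -b`. -/
def sgnSwap (a b x : ℤ) : ℤ :=
  if x = a then b else if x = b then a else if x = -a then -b else if x = -b then -a else x

/-- The action of the generator number `i` of type `D` on `ℤ`. -/
def refl (i : ℕ) (x : ℤ) : ℤ :=
  if i = 0 then sgnSwap 1 (-2) x else sgnSwap i (i + 1) x

theorem sgnSwap_spec (a b x : ℤ) :
    (x = a ∧ sgnSwap a b x = b) ∨ (x = b ∧ sgnSwap a b x = a) ∨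
    (x = -a ∧ sgnSwap a b x = -b) ∨ (x = -b ∧ sgnSwap a b x = -a) ∨
    (x ≠ a ∧ x ≠ b ∧ x ≠ -a ∧ x ≠ -b ∧ sgnSwap a b x = x) := by
  unfold sgnSwap
  split_ifs <;> simp [*]

theorem sgnSwap_comm {a b : ℤ} (h : a ≠ b) (h' : a ≠ -b) (ha : a ≠ 0) (hb : b ≠ 0) (x : ℤ) :
    sgnSwap a b x = sgnSwap b a x := by
  unfold sgnSwap
  split_ifs <;> omega

theorem sgnSwap_neg_neg {a b : ℤ} (h : a ≠ b) (h' : a ≠ -b) (ha : a ≠ 0) (hb : b ≠ 0) (x : ℤ) :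
    sgnSwap (-a) (-b) x = sgnSwap a b x := by
  unfold sgnSwap
  split_ifs <;> omega

/-- Conjugation of signed transpositions by odd injective maps. -/
theorem sgnSwap_conj (f : ℤ → ℤ) (hf : Function.Injective f) (hodd : ∀ x, f (-x) = -f x)
    (a b x : ℤ) : f (sgnSwap a b x) = sgnSwap (f a) (f b) (f x) := by
  unfold sgnSwap
  simp only [hf.eq_iff, ← hodd]
  split_ifs <;> rfl

theorem sgnSwap_neg {a b : ℤ} (h : a ≠ b) (h' : a ≠ -b) (ha : a ≠ 0) (hb : b ≠ 0) (x : ℤ) :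
    sgnSwap a b (-x) = -sgnSwap a b x := by
  unfold sgnSwap
  split_ifs <;> omega

theorem sgnSwap_sgnSwap {a b : ℤ} (h : a ≠ b) (h' : a ≠ -b) (ha : a ≠ 0) (hb : b ≠ 0) (x : ℤ) :
    sgnSwap a b (sgnSwap a b x) = x := by
  rcases sgnSwap_spec a b x with h1 | h1 | h1 | h1 | h1 <;>
  rcases sgnSwap_spec a b (sgnSwap a b x) with h2 | h2 | h2 | h2 | h2 <;> omega

theorem refl_zero : refl 0 = sgnSwap 1 (-2) := by funext x; simp [refl]

theorem refl_pos {i : ℕ} (h : i ≠ 0) : refl i = sgnSwap i (i + 1) := by funext x; simp [refl, h]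

theorem refl_refl (i : ℕ) (x : ℤ) : refl i (refl i x) = x := by
  by_cases h : i = 0
  · subst h; rw [refl_zero]; exact sgnSwap_sgnSwap (by omega) (by omega) (by omega) (by omega) x
  · rw [refl_pos h]; exact sgnSwap_sgnSwap (by omega) (by omega) (by omega) (by omega) x

theorem refl_neg (i : ℕ) (x : ℤ) : refl i (-x) = -refl i x := by
  by_cases h : i = 0
  · subst h; rw [refl_zero]; exact sgnSwap_neg (by omega) (by omega) (by omega) (by omega) x
  · rw [refl_pos h]; exact sgnSwap_neg (by omega) (by omega) (by omega) (by omega) x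

theorem refl_injective (i : ℕ) : Function.Injective (refl i) :=
  Function.LeftInverse.injective (refl_refl i)

/-- The same as a permutation. -/
def reflPerm (i : ℕ) : Equiv.Perm ℤ := ⟨refl i, refl i, refl_refl i, refl_refl i⟩

@[simp] theorem reflPerm_apply (i : ℕ) (x : ℤ) : reflPerm i x = refl i x := rfl

/-- Adjacency `i < j` in the type `D` diagram on `ℕ`. -/
def DAdj (i j : ℕ) : Prop := (i = 0 ∧ j = 2) ∨ (1 ≤ i ∧ j = i + 1)

theorem refl_comm {i j : ℕ} (hij : i < j) (h : ¬ DAdj i j) (x : ℤ) :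
    refl i (refl j x) = refl j (refl i x) := by
  unfold DAdj at h
  have hj : j ≠ 0 := by omega
  rw [refl_pos hj, sgnSwap_conj (refl i) (refl_injective i) (refl_neg i)]
  by_cases hj1 : j = 1
  · subst hj1
    obtain rfl : i = 0 := by omega
    have e1 : refl 0 1 = -2 := by simp [refl, sgnSwap]
    have e2 : refl 0 2 = -1 := by simp [refl, sgnSwap]
    norm_num
    rw [e1, e2, sgnSwap_neg_neg (by omega) (by omega) (by omega) (by omega),
      sgnSwap_comm (by omega) (by omega) (by omega) (by omega)]
  · have key : ∀ y : ℤ, (j : ℤ) ≤ y → refl i y = y := by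
      intro y hy
      by_cases hi : i = 0
      · subst hi
        rw [refl_zero]
        have := sgnSwap_spec 1 (-2) y
        omega
      · rw [refl_pos hi]
        have := sgnSwap_spec i (i + 1) y
        omega
    have e1 : refl i j = j := key _ (by omega)
    have e2 : refl i (j + 1) = j + 1 := key _ (by omega)
    rw [e1, e2]

theorem refl_braid {i j : ℕ} (h : DAdj i j) (x : ℤ) :
    refl i (refl j (refl i x)) = refl j (refl i (refl j x)) := by
  have hj : j ≠ 0 := by unfold DAdj at h; omega
  have A : refl i (refl j (refl i x)) = sgnSwap (refl i j) (refl i (j + 1)) x := by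
    rw [refl_pos hj, sgnSwap_conj (refl i) (refl_injective i) (refl_neg i), refl_refl]
  rw [A]
  rcases h with ⟨rfl, rfl⟩ | ⟨h, rfl⟩
  · have B : refl 0 (refl 2 x) = sgnSwap 1 (-2) (refl 2 x) := by rw [refl_zero]
    rw [B, sgnSwap_conj (refl 2) (refl_injective 2) (refl_neg 2), refl_refl]
    have e1 : refl 0 (2 : ℕ) = -1 := by simp [refl, sgnSwap]
    have e2 : refl 0 ((2 : ℕ) + 1) = - (-3) := by simp [refl, sgnSwap]
    have e3 : refl 2 1 = 1 := by simp [refl, sgnSwap]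
    have e4 : refl 2 (-2) = -3 := by simp [refl, sgnSwap]
    rw [e1, e2, e3, e4, sgnSwap_neg_neg (by omega) (by omega) (by omega) (by omega)]
  · have B : refl i (refl (i + 1) x) = sgnSwap i (i + 1) (refl (i + 1) x) := by
      rw [refl_pos (i := i) (by omega)]
    rw [B, sgnSwap_conj (refl (i + 1)) (refl_injective _) (refl_neg _), refl_refl]
    have e1 : refl i ((i + 1 : ℕ) : ℤ) = i := by
      rw [refl_pos (i := i) (by omega)]
      have := sgnSwap_spec i (i + 1) ((i + 1 : ℕ) : ℤ)
      omega
    have e2 : refl i (((i + 1 : ℕ) : ℤ) + 1) = i + 2 := by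
      rw [refl_pos (i := i) (by omega)]
      have := sgnSwap_spec i (i + 1) (((i + 1 : ℕ) : ℤ) + 1)
      omega
    have e3 : refl (i + 1) i = i := by
      rw [refl_pos (by omega)]
      have := sgnSwap_spec (i + 1 : ℕ) ((i + 1 : ℕ) + 1) i
      omega
    have e4 : refl (i + 1) (i + 1) = i + 2 := by
      rw [refl_pos (by omega)]
      have := sgnSwap_spec (i + 1 : ℕ) ((i + 1 : ℕ) + 1) (i + 1)
      omega
    rw [e1, e2, e3, e4]

/-- A family of elements satisfying the relations of type `D_m`, together with a lift of the
signed permutation action. -/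
structure DSys (G : Type*) [Group G] (m : ℕ) where
  s : ℕ → G
  ρ : G →* Equiv.Perm ℤ
  sq : ∀ i, i < m → s i * s i = 1
  comm : ∀ i j, i < j → j < m → ¬ DAdj i j → s i * s j = s j * s i
  braid : ∀ i j, DAdj i j → j < m → s i * s j * s i = s j * s i * s j
  hρ : ∀ i, i < m → ∀ x, ρ (s i) x = refl i x

namespace DSys

variable {G : Type*} [Group G] {m : ℕ} (D : DSys G m)

/-- The parabolic subgroup generated by the first `k` generators. -/
def H (k : ℕ) : Subgroup G := Subgroup.closure (D.s '' Set.Iio k)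

theorem s_mem {k j : ℕ} (h : j < k) : D.s j ∈ D.H k :=
  Subgroup.subset_closure ⟨j, h, rfl⟩

theorem H_mono {k l : ℕ} (h : k ≤ l) : D.H k ≤ D.H l :=
  Subgroup.closure_mono (Set.image_mono (Set.Iio_subset_Iio h))

theorem s_inv {j : ℕ} (h : j < m) : (D.s j)⁻¹ = D.s j :=
  inv_eq_of_mul_eq_one_left (D.sq j h)

theorem H_induction {k : ℕ} (hk : k ≤ m) {p : (w : G) → w ∈ D.H k → Prop}
    (h1 : p 1 (one_mem _))
    (hs : ∀ j, ∀ hj : j < k, ∀ w hw, p w hw → p (D.s j * w) (mul_mem (D.s_mem hj) hw))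
    {w : G} (hw : w ∈ D.H k) : p w hw := by
  induction hw using Subgroup.closure_induction_left with
  | one => exact h1
  | mul_left x hx y hy ih =>
    obtain ⟨j, hj, rfl⟩ := hx
    exact hs j hj y hy ih
  | inv_mul_cancel x hx y hy ih =>
    obtain ⟨j, hj, rfl⟩ := hx
    have e := D.s_inv (lt_of_lt_of_le hj hk)
    simp only [e]
    exact hs j hj y hy ih

theorem ρ_neg {w : G} (hw : w ∈ D.H m) (x : ℤ) : D.ρ w (-x) = - D.ρ w x := by
  induction hw using D.H_induction le_rfl with
  | h1 => simp
  | hs j hj w hw ih => simp [D.hρ j hj, ih, refl_neg]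

theorem ρ_fix {k : ℕ} (hk : k ≤ m) (hk2 : 2 ≤ k) {w : G} (hw : w ∈ D.H k) (x : ℤ)
    (hx : (k : ℤ) < |x|) : D.ρ w x = x := by
  induction hw using D.H_induction hk with
  | h1 => simp
  | hs j hj w hw ih =>
    simp only [map_mul, Equiv.Perm.mul_apply, ih, D.hρ j (lt_of_lt_of_le hj hk)]
    rcases lt_abs.1 hx with h | h <;>
    · unfold refl sgnSwap
      split_ifs <;> omega

/-- `Pd k d = s_{k-d+1} ⋯ s_k`. -/
def Pd (k : ℕ) : ℕ → G
  | 0 => 1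
  | d + 1 => D.s (k - d) * Pd k d

/-- `P k i = s_i ⋯ s_k`. -/
def P (k i : ℕ) : G := D.Pd k (k + 1 - i)

theorem P_top (k : ℕ) : D.P k (k + 1) = 1 := by simp [P, Pd]

theorem P_eq {k i : ℕ} (h : i ≤ k) : D.P k i = D.s i * D.P k (i + 1) := by
  unfold P
  have : k + 1 - i = (k - i) + 1 := by omega
  rw [this, Pd]
  congr 2
  · omega
  · omega

/-- `N k i = s_{i-1} ⋯ s_1 s_0 s_2 ⋯ s_k`. -/
def N (k : ℕ) : ℕ → G
  | 0 => D.s 0 * D.P k 2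
  | 1 => D.s 0 * D.P k 2
  | i + 2 => D.s (i + 1) * N k (i + 1)

theorem N_one (k : ℕ) : D.N k 1 = D.s 0 * D.P k 2 := rfl

theorem N_succ (k i : ℕ) (h : 1 ≤ i) : D.N k (i + 1) = D.s i * D.N k i := by
  obtain ⟨i, rfl⟩ : ∃ j, i = j + 1 := ⟨i - 1, by omega⟩
  rfl

theorem sq_mul {i : ℕ} (h : i < m) (g : G) : D.s i * (D.s i * g) = g := by
  rw [← mul_assoc, D.sq i h, one_mul]

theorem comm_mul {i j : ℕ} (h : i < j) (hj : j < m) (ha : ¬ DAdj i j) (g : G) :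
    D.s i * (D.s j * g) = D.s j * (D.s i * g) := by
  rw [← mul_assoc, D.comm i j h hj ha, mul_assoc]

theorem braid_mul {i j : ℕ} (hj : j < m) (ha : DAdj i j) (g : G) :
    D.s i * (D.s j * (D.s i * g)) = D.s j * (D.s i * (D.s j * g)) := by
  have := D.braid i j ha hj
  simp only [← mul_assoc]
  rw [this]

theorem L1 {k : ℕ} (hk : k < m) {i j : ℕ} (hi : i ≤ k + 1) (h3 : 3 ≤ i) (hj : j + 2 ≤ i) :
    D.s j * D.P k i = D.P k i * D.s j := by
  induction hi using Nat.decreasingInduction with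
  | self => simp [P_top]
  | of_succ i hi ih =>
    rw [D.P_eq (by omega), D.comm_mul (by omega) (by omega) (by unfold DAdj; omega),
      ih (by omega) (by omega), mul_assoc]

theorem L2 {k : ℕ} (hk : k < m) {i j : ℕ} (hi : i ≤ k + 1) (h1 : 1 ≤ i) (hij : i < j)
    (hj : j ≤ k) : D.s j * D.P k i = D.P k i * D.s (j - 1) := by
  induction hi using Nat.decreasingInduction with
  | self => omega
  | of_succ i hi ih =>
    rw [D.P_eq (by omega)]
    by_cases h : j = i + 1
    · subst h
      rw [D.P_eq (by omega), ← D.braid_mul (by omega) (by unfold DAdj; omega),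
        D.L1 hk (by omega) (by omega) (by omega)]
      simp [mul_assoc]
    · rw [← D.comm_mul (by omega) (by omega) (by unfold DAdj; omega), ih (by omega) (by omega),
        mul_assoc]

theorem L3 {k : ℕ} (hk : k < m) (h2 : 2 ≤ k) : D.s 2 * D.N k 1 = D.N k 1 * D.s 0 := by
  rw [N_one, D.P_eq h2, ← D.braid_mul (by omega) (by unfold DAdj; omega),
    D.L1 hk (by omega) (by omega) (by omega)]
  simp [mul_assoc]

theorem L4 {k : ℕ} (hk : k < m) {i j : ℕ} (hi : 1 ≤ i) (hj3 : 3 ≤ j) (hij : i < j) (hj : j ≤ k) :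
    D.s j * D.N k i = D.N k i * D.s (j - 1) := by
  induction i, hi using Nat.le_induction with
  | base =>
    rw [N_one, ← D.comm_mul (by omega) (by omega) (by unfold DAdj; omega),
      D.L2 hk (by omega) (by omega) (by omega) (by omega), mul_assoc]
  | succ i hi ih =>
    rw [D.N_succ k i hi, ← D.comm_mul (by omega) (by omega) (by unfold DAdj; omega),
      ih (by omega), mul_assoc]

theorem L5 {k : ℕ} (hk : k < m) {i j : ℕ} (hj : 1 ≤ j) (hij : j + 2 ≤ i) (hi : i ≤ k + 1) :
    ∃ h ∈ D.H k, D.s j * D.N k i = D.N k i * h := by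
  induction i, hij using Nat.le_induction with
  | base =>
    rw [D.N_succ k (j + 1) (by omega), D.N_succ k j hj,
      D.braid_mul (by omega) (by unfold DAdj; omega)]
    by_cases h1 : j = 1
    · subst h1
      exact ⟨D.s 0, D.s_mem (by omega), by rw [D.L3 hk (by omega)]; simp [mul_assoc]⟩
    · exact ⟨D.s j, D.s_mem (by omega), by
        rw [D.L4 hk (by omega) (by omega) (by omega) (by omega)]; simp [mul_assoc]⟩
  | succ i hi' ih =>
    obtain ⟨h, hh, e⟩ := ih (by omega)
    refine ⟨h, hh, ?_⟩
    rw [D.N_succ k i (by omega), D.comm_mul (by omega) (by omega) (by unfold DAdj; omega), e,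
      mul_assoc]

theorem L6 {k : ℕ} (hk : k < m) {i : ℕ} (hi3 : 3 ≤ i) (hi : i ≤ k + 1) :
    D.s 0 * D.N k i = D.N k i * D.s 1 := by
  induction i, hi3 using Nat.le_induction with
  | base =>
    rw [D.N_succ k 2 (by omega), D.N_succ k 1 (by omega), N_one]
    have c01 : ∀ g, D.s 0 * (D.s 1 * g) = D.s 1 * (D.s 0 * g) :=
      D.comm_mul (by omega) (by omega) (by unfold DAdj; omega)
    rw [← c01, D.braid_mul (by omega) (by unfold DAdj; omega), D.P_eq (i := 2) (by omega),
      ← D.braid_mul (i := 1) (j := 2) (by omega) (by unfold DAdj; omega),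
      D.L1 hk (by omega) (by omega) (by omega)]
    simp [mul_assoc]
  | succ i hi' ih =>
    rw [D.N_succ k i (by omega), D.comm_mul (by omega) (by omega) (by unfold DAdj; omega),
      ih (by omega), mul_assoc]

/-- Coset representatives. -/
def IsRep (k : ℕ) (u : G) : Prop := ∃ i, 1 ≤ i ∧ i ≤ k + 1 ∧ (u = D.P k i ∨ u = D.N k i)

theorem rep_step {k : ℕ} (hk1 : 1 ≤ k) (hk : k < m) {u : G} (hu : D.IsRep k u) {j : ℕ}
    (hj : j ≤ k) : ∃ u', D.IsRep k u' ∧ ∃ h ∈ D.H k, D.s j * u = u' * h := by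
  obtain ⟨i, hi1, hi, rfl | rfl⟩ := hu
  · by_cases hj0 : j = 0
    · subst hj0
      by_cases h1 : i = 1
      · subst h1
        refine ⟨D.N k 2, ⟨2, by omega, by omega, Or.inr rfl⟩, 1, one_mem _, ?_⟩
        rw [D.P_eq hk1, D.comm_mul (by omega) (by omega) (by unfold DAdj; omega),
          D.N_succ k 1 le_rfl, N_one, mul_one]
      by_cases h2 : i = 2
      · subst h2
        exact ⟨D.N k 1, ⟨1, by omega, by omega, Or.inr rfl⟩, 1, one_mem _, by rw [N_one, mul_one]⟩
      · exact ⟨D.P k i, ⟨i, hi1, hi, Or.inl rfl⟩, D.s 0, D.s_mem (by omega),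
          D.L1 hk hi (by omega) (by omega)⟩
    by_cases hji : j = i
    · subst hji
      exact ⟨D.P k (j + 1), ⟨j + 1, by omega, by omega, Or.inl rfl⟩, 1, one_mem _, by
        rw [D.P_eq hj, D.sq_mul (by omega), mul_one]⟩
    by_cases hji : j + 1 = i
    · subst hji
      exact ⟨D.P k j, ⟨j, by omega, by omega, Or.inl rfl⟩, 1, one_mem _, by
        rw [D.P_eq hj, mul_one]⟩
    by_cases hlt : i < j
    · exact ⟨D.P k i, ⟨i, hi1, hi, Or.inl rfl⟩, D.s (j - 1), D.s_mem (by omega),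
          D.L2 hk hi hi1 hlt hj⟩
    · exact ⟨D.P k i, ⟨i, hi1, hi, Or.inl rfl⟩, D.s j, D.s_mem (by omega),
          D.L1 hk hi (by omega) (by omega)⟩
  · by_cases hj0 : j = 0
    · subst hj0
      by_cases h1 : i = 1
      · subst h1
        exact ⟨D.P k 2, ⟨2, by omega, by omega, Or.inl rfl⟩, 1, one_mem _, by
          rw [N_one, D.sq_mul (by omega), mul_one]⟩
      by_cases h2 : i = 2
      · subst h2
        refine ⟨D.P k 1, ⟨1, by omega, by omega, Or.inl rfl⟩, 1, one_mem _, ?_⟩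
        rw [D.N_succ k 1 le_rfl, D.comm_mul (by omega) (by omega) (by unfold DAdj; omega), N_one,
          D.sq_mul (by omega), D.P_eq hk1, mul_one]
      · exact ⟨D.N k i, ⟨i, hi1, hi, Or.inr rfl⟩, D.s 1, D.s_mem (by omega),
          D.L6 hk (by omega) (by omega)⟩
    by_cases hji : j = i
    · subst hji
      exact ⟨D.N k (j + 1), ⟨j + 1, by omega, by omega, Or.inr rfl⟩, 1, one_mem _, by
        rw [D.N_succ k j hi1, mul_one]⟩
    by_cases hji : j + 1 = i
    · subst hji
      exact ⟨D.N k j, ⟨j, by omega, by omega, Or.inr rfl⟩, 1, one_mem _, by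
        rw [D.N_succ k j (by omega), D.sq_mul (by omega), mul_one]⟩
    refine ⟨D.N k i, ⟨i, hi1, hi, Or.inr rfl⟩, ?_⟩
    by_cases hlt : i < j
    · by_cases h2 : j = 2
      · obtain rfl : i = 1 := by omega
        subst h2
        exact ⟨D.s 0, D.s_mem (by omega), D.L3 hk hj⟩
      · exact ⟨D.s (j - 1), D.s_mem (by omega), D.L4 hk hi1 (by omega) hlt hj⟩
    · exact D.L5 hk (by omega) (by omega) hi

theorem cover {k : ℕ} (hk1 : 1 ≤ k) (hk : k < m) {w : G} (hw : w ∈ D.H (k + 1)) :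
    ∃ u, D.IsRep k u ∧ ∃ h ∈ D.H k, w = u * h := by
  induction hw using D.H_induction hk with
  | h1 => exact ⟨1, ⟨k + 1, by omega, le_rfl, Or.inl (D.P_top k).symm⟩, 1, one_mem _, by simp⟩
  | hs j hj w hw ih =>
    obtain ⟨u, hu, h, hh, rfl⟩ := ih
    obtain ⟨u', hu', h', hh', e⟩ := D.rep_step hk1 hk hu (j := j) (by omega)
    exact ⟨u', hu', h' * h, mul_mem hh' hh, by rw [← mul_assoc, e, mul_assoc]⟩

theorem ρ_P {k : ℕ} (hk : k < m) {i : ℕ} (hi : i ≤ k + 1) (h1 : 1 ≤ i) :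
    D.P k i ∈ D.H (k + 1) ∧ D.ρ (D.P k i) (k + 1) = i := by
  induction hi using Nat.decreasingInduction with
  | self => simp [P_top]
  | of_succ i hi ih =>
    obtain ⟨a, b⟩ := ih (by omega)
    rw [D.P_eq (by omega)]
    refine ⟨mul_mem (D.s_mem (by omega)) a, ?_⟩
    simp only [map_mul, Equiv.Perm.mul_apply, b]
    rw [D.hρ i (by omega)]
    unfold refl sgnSwap
    split_ifs <;> omega

theorem ρ_N {k : ℕ} (hk : k < m) (hk1 : 1 ≤ k) {i : ℕ} (hi : i ≤ k + 1) (h1 : 1 ≤ i) :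
    D.N k i ∈ D.H (k + 1) ∧ D.ρ (D.N k i) (k + 1) = -i := by
  induction i, h1 using Nat.le_induction with
  | base =>
    obtain ⟨a, b⟩ := D.ρ_P hk (i := 2) (by omega) (by omega)
    refine ⟨mul_mem (D.s_mem (by omega)) a, ?_⟩
    rw [N_one]
    simp only [map_mul, Equiv.Perm.mul_apply, b]
    rw [D.hρ 0 (by omega)]
    simp [refl, sgnSwap]
  | succ i h1 ih =>
    obtain ⟨a, b⟩ := ih (by omega)
    rw [D.N_succ k i h1]
    refine ⟨mul_mem (D.s_mem (by omega)) a, ?_⟩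
    simp only [map_mul, Equiv.Perm.mul_apply, b]
    rw [D.hρ i (by omega)]
    unfold refl sgnSwap
    split_ifs <;> omega

theorem faithful {k : ℕ} (h2 : 2 ≤ k) (hk : k ≤ m) {w : G} (hw : w ∈ D.H k) (h : D.ρ w = 1) :
    w = 1 := by
  induction k, h2 using Nat.le_induction generalizing w with
  | base =>
    have key : w = 1 ∨ w = D.s 0 ∨ w = D.s 1 ∨ w = D.s 0 * D.s 1 := by
      clear h
      have q0 := D.sq 0 (by omega)
      have q1 := D.sq 1 (by omega)
      have c : D.s 0 * D.s 1 = D.s 1 * D.s 0 :=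
        D.comm 0 1 (by omega) (by omega) (by unfold DAdj; omega)
      have c' : D.s 1 * (D.s 0 * D.s 1) = D.s 0 := by rw [c, ← mul_assoc, q1, one_mul]
      have c'' : D.s 0 * (D.s 0 * D.s 1) = D.s 1 := by rw [← mul_assoc, q0, one_mul]
      induction hw using D.H_induction hk with
      | h1 => simp
      | hs j hj w hw ih =>
        obtain rfl | rfl : j = 0 ∨ j = 1 := by omega
        · rcases ih with rfl | rfl | rfl | rfl <;> simp [q0, c'']
        · rcases ih with rfl | rfl | rfl | rfl <;> simp [q1, c', c, D.sq_mul (i := 1) (by omega)]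
    have e0 := D.hρ 0 (by omega)
    have e1 := D.hρ 1 (by omega)
    have h' : D.ρ w 1 = 1 := by rw [h]; rfl
    rcases key with rfl | rfl | rfl | rfl
    · rfl
    · simp [e0, refl, sgnSwap] at h'
    · simp [e1, refl, sgnSwap] at h'
    · simp [e0, e1, refl, sgnSwap] at h'
  | succ k h2 ih =>
    obtain ⟨u, ⟨i, hi1, hi, hu⟩, g, hg, rfl⟩ := D.cover (by omega) (by omega) hw
    have h' : D.ρ (u * g) (k + 1) = k + 1 := by rw [h]; rfl
    rw [map_mul, Equiv.Perm.mul_apply, D.ρ_fix (by omega) h2 hg _ (by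
      rw [abs_of_nonneg (by omega)]; omega)] at h'
    rcases hu with rfl | rfl
    · rw [(D.ρ_P (by omega) hi hi1).2] at h'
      obtain rfl : i = k + 1 := by omega
      rw [D.P_top, one_mul] at h ⊢
      exact ih (by omega) hg h
    · rw [(D.ρ_N (by omega) (by omega) hi hi1).2] at h'
      omega

/-- Exchange `1` and `-1`. -/
def eps (x : ℤ) : ℤ := if x = 1 then -1 else if x = -1 then 1 else x

theorem surj {n : ℕ} (h1 : 1 ≤ n) (hn : n ≤ m) (f : ℤ → ℤ) (hf : Function.Injective f)
    (hodd : ∀ x, f (-x) = - f x) (hfix : ∀ x, (n : ℤ) < |x| → f x = x) :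
    ∃ h ∈ D.H n, (∀ x, f x = D.ρ h x) ∨ (∀ x, f x = D.ρ h (eps x)) := by
  induction n, h1 using Nat.le_induction generalizing f with
  | base =>
    have f0 : f 0 = 0 := by have := hodd 0; simp at this; omega
    have hb : f 1 = 1 ∨ f 1 = -1 := by
      by_contra hc
      by_cases hz : f 1 = 0
      · have := hf (hz.trans f0.symm); omega
      · have := hfix (f 1) (by
          rw [lt_abs]; push_cast; omega)
        have := hf this; omega
    have hm1 := hodd 1
    refine ⟨1, one_mem _, ?_⟩
    have hx : ∀ x, x = 0 ∨ x = 1 ∨ x = -1 ∨ f x = x := by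
      intro x
      by_cases c : (1 : ℤ) < |x|
      · right; right; right; exact hfix x (by simpa using c)
      · rw [lt_abs] at c; omega
    rcases hb with hb | hb
    · left; intro x
      simp only [map_one, Equiv.Perm.one_apply]
      rcases hx x with rfl | rfl | rfl | h <;> omega
    · right; intro x
      simp only [map_one, Equiv.Perm.one_apply]
      unfold eps
      rcases hx x with rfl | rfl | rfl | h
      · simpa using f0
      · simpa using hb
      · simp; omega
      · split_ifs with h1 h2
        · subst h1; omega
        · subst h2; omega
        · exact h
  | succ n h1 ih =>
    have f0 : f 0 = 0 := by have := hodd 0; simp at this; omega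
    obtain ⟨u, hu, hun⟩ : ∃ u ∈ D.H (n + 1), D.ρ u (n + 1) = f (n + 1) := by
      have a0 : f (n + 1) ≠ 0 := by
        intro hz; have := hf (hz.trans f0.symm); omega
      have a1 : ¬ (((n + 1 : ℕ) : ℤ) < |f (n + 1)|) := by
        intro hc
        have := hf (hfix _ hc)
        rw [this, abs_of_nonneg (by omega)] at hc
        omega
      rw [lt_abs] at a1
      rcases lt_or_gt_of_ne a0 with hneg | hpos
      · obtain ⟨a, b⟩ := D.ρ_N (k := n) (by omega) h1 (i := (-f (n + 1)).toNat) (by omega) (by omega)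
        exact ⟨_, a, by rw [b]; omega⟩
      · obtain ⟨a, b⟩ := D.ρ_P (k := n) (by omega) (i := (f (n + 1)).toNat) (by omega) (by omega)
        exact ⟨_, a, by rw [b]; omega⟩
    have hui : u⁻¹ ∈ D.H (n + 1) := inv_mem hu
    have hinv : ∀ y, D.ρ u (D.ρ u⁻¹ y) = y := by
      intro y; rw [← Equiv.Perm.mul_apply, ← map_mul]; simp
    have hinv' : ∀ y, D.ρ u⁻¹ (D.ρ u y) = y := by
      intro y; rw [← Equiv.Perm.mul_apply, ← map_mul]; simp
    have hodd' : ∀ x, D.ρ u⁻¹ (f (-x)) = - D.ρ u⁻¹ (f x) := by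
      intro x; rw [hodd, D.ρ_neg (D.H_mono hn hui)]
    have htop : D.ρ u⁻¹ (f (n + 1)) = n + 1 := by rw [← hun, hinv']
    obtain ⟨h, hh, e⟩ := ih (by omega) (fun x => D.ρ u⁻¹ (f x))
      ((D.ρ u⁻¹).injective.comp hf) hodd' (by
        intro x hx
        by_cases c1 : x = n + 1
        · subst c1; exact htop
        by_cases c2 : x = -(n + 1)
        · subst c2; rw [hodd', htop]
        have hx' : ((n + 1 : ℕ) : ℤ) < |x| := by rw [lt_abs] at hx ⊢; omega
        change D.ρ u⁻¹ (f x) = x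
        rw [hfix x hx', D.ρ_fix hn (by omega) hui x hx'])
    refine ⟨u * h, mul_mem hu (D.H_mono (by omega) hh), ?_⟩
    rcases e with e | e
    · left; intro x
      rw [map_mul, Equiv.Perm.mul_apply, ← e, hinv]
    · right; intro x
      rw [map_mul, Equiv.Perm.mul_apply, ← e, hinv]

/-- The element negating `1` and `i + 2`. -/
theorem exists_neg_pair {i : ℕ} (hi : i + 2 ≤ m) : ∃ h ∈ D.H (i + 2), ∀ x, D.ρ h x =
    if x = 1 ∨ x = -1 ∨ x = i + 2 ∨ x = -(i + 2) then -x else x := by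
  induction i with
  | zero =>
    refine ⟨D.s 0 * D.s 1, mul_mem (D.s_mem (by omega)) (D.s_mem (by omega)), ?_⟩
    intro x
    simp only [map_mul, Equiv.Perm.mul_apply, D.hρ 0 (show 0 < m by omega),
      D.hρ 1 (show 1 < m by omega)]
    rw [refl_zero, refl_pos one_ne_zero]
    norm_num only [Nat.cast_one, Nat.cast_zero]
    rcases sgnSwap_spec 1 2 x with h1 | h1 | h1 | h1 | h1 <;>
    rcases sgnSwap_spec 1 (-2) (sgnSwap 1 2 x) with h2 | h2 | h2 | h2 | h2 <;>
    split_ifs <;> omega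
  | succ i ih =>
    obtain ⟨h, hh, e⟩ := ih (by omega)
    refine ⟨D.s (i + 2) * h * D.s (i + 2), mul_mem (mul_mem (D.s_mem (by omega))
      (D.H_mono (by omega) hh)) (D.s_mem (by omega)), ?_⟩
    intro x
    simp only [map_mul, Equiv.Perm.mul_apply, D.hρ (i + 2) (show i + 2 < m by omega), e]
    obtain ⟨y, hy⟩ : ∃ y, y = refl (i + 2) x := ⟨_, rfl⟩
    have hyx : x = refl (i + 2) y := by rw [hy, refl_refl]
    rw [← hy, apply_ite (refl (i + 2)), refl_neg, ← hyx]
    rw [refl_pos (by omega)] at hy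
    rcases sgnSwap_spec ((i + 2 : ℕ) : ℤ) ((i + 2 : ℕ) + 1) x with h1 | h1 | h1 | h1 | h1 <;>
    split_ifs <;> omega

theorem exists_neg_all {k : ℕ} (hk : 2 * k + 1 ≤ m) : ∃ h ∈ D.H (2 * k + 1), ∀ x, D.ρ h x =
    if 2 ≤ |x| ∧ |x| ≤ 2 * (k : ℤ) + 1 then -x else x := by
  induction k with
  | zero =>
    refine ⟨1, one_mem _, fun x => ?_⟩
    rw [if_neg]
    · simp
    · push_cast; omega
  | succ k ih =>
    obtain ⟨h, hh, e⟩ := ih (by omega)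
    obtain ⟨a, ha, ea⟩ := D.exists_neg_pair (i := 2 * k) (by omega)
    obtain ⟨b, hb, eb⟩ := D.exists_neg_pair (i := 2 * k + 1) (by omega)
    refine ⟨a * b * h, mul_mem (mul_mem (D.H_mono (by omega) ha) (D.H_mono (by omega) hb))
      (D.H_mono (by omega) hh), fun x => ?_⟩
    simp only [map_mul, Equiv.Perm.mul_apply, e, ea, eb]
    push_cast
    rcases abs_cases x with ⟨hx, _⟩ | ⟨hx, _⟩ <;> rw [hx] <;> split_ifs <;> omega

/-- Up to a global sign, every odd injection moving only `±1, …, ±n` comes from `H n`, for `n` odd. -/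
theorem surj_odd {n : ℕ} (hno : Odd n) (hn : n ≤ m) (f : ℤ → ℤ)
    (hf : Function.Injective f)
    (hodd : ∀ x, f (-x) = - f x) (hfix : ∀ x, (n : ℤ) < |x| → f x = x) :
    ∃ h ∈ D.H n, (∀ x, f x = D.ρ h x) ∨ (∀ x, |x| ≤ (n : ℤ) → f (-x) = D.ρ h x) := by
  obtain ⟨k, rfl⟩ := hno
  obtain ⟨h, hh, e | e⟩ := D.surj (by omega) hn f hf hodd hfix
  · exact ⟨h, hh, Or.inl e⟩
  · obtain ⟨g, hg, eg⟩ := D.exists_neg_all hn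
    refine ⟨h * g, mul_mem hh hg, Or.inr fun x hx => ?_⟩
    rw [e, map_mul, Equiv.Perm.mul_apply, eg]
    congr 1
    unfold eps
    push_cast at hx
    rcases abs_cases x with ⟨hx', _⟩ | ⟨hx', _⟩ <;> rw [hx'] at hx ⊢ <;> split_ifs <;> omega

end DSys
end ArtinTits

namespace ArtinTits

theorem extend_odd (n : ℕ) (U : Set ℤ) (t : ℤ → ℤ) (ht : Function.Injective t)
    (hodd : ∀ x, t (-x) = -t x) (hUneg : ∀ x ∈ U, -x ∈ U) (hU : ∀ x ∈ U, 1 ≤ |x| ∧ |x| ≤ (n : ℤ))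
    (htU : ∀ x ∈ U, 1 ≤ |t x| ∧ |t x| ≤ (n : ℤ)) :
    ∃ f : ℤ → ℤ, Function.Injective f ∧ (∀ x, f (-x) = -f x) ∧ (∀ x, (n : ℤ) < |x| → f x = x) ∧
      ∀ x ∈ U, f x = t x := by
  classical
  obtain ⟨g, hg⟩ := Set.MapsTo.exists_equiv_extend_of_card_eq
    (α := ↥(Finset.Icc (1 : ℤ) n)) (t := Finset.Icc (1 : ℤ) n) (by simp)
    (s := {i | (i : ℤ) ∈ U}) (f := fun i => |t i|)
    (by intro i hi; simp only [Finset.coe_Icc, Set.mem_Icc]; exact htU _ hi)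
    (by
      intro i hi j hj h
      have h' : |t i| = |t j| := h
      rw [abs_eq_abs] at h'
      have pi := Finset.mem_Icc.1 i.2
      have pj := Finset.mem_Icc.1 j.2
      rcases h' with h' | h'
      · exact Subtype.ext (ht h')
      · rw [← hodd] at h'
        have := ht h'
        omega)
  -- absolute value extension
  let G : ℤ → ℤ := fun x => if h : x ∈ Finset.Icc (1 : ℤ) n then (g ⟨x, h⟩ : ℤ) else x
  have Gr : ∀ x : ℤ, 1 ≤ x → x ≤ n → 1 ≤ G x ∧ G x ≤ n := by
    intro x h1 h2
    have hx : x ∈ Finset.Icc (1 : ℤ) n := Finset.mem_Icc.2 ⟨h1, h2⟩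
    simp only [G, dif_pos hx]
    exact Finset.mem_Icc.1 (g ⟨x, hx⟩).2
  have Gn : ∀ x, (n : ℤ) < x → G x = x := by
    intro x h1
    have hx : x ∉ Finset.Icc (1 : ℤ) n := by rw [Finset.mem_Icc]; omega
    simp only [G, dif_neg hx]
  have G0 : G 0 = 0 := by simp [G]
  have Gt : ∀ x ∈ U, 1 ≤ x → x ≤ n → G x = |t x| := by
    intro x hxU h1 h2
    have hx : x ∈ Finset.Icc (1 : ℤ) n := Finset.mem_Icc.2 ⟨h1, h2⟩
    simp only [G, dif_pos hx]
    exact hg ⟨x, hx⟩ hxU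
  have Gi : ∀ x y, 0 ≤ x → 0 ≤ y → G x = G y → x = y := by
    intro x y hx hy h
    by_cases h1 : x ∈ Finset.Icc (1 : ℤ) n
    · by_cases h2 : y ∈ Finset.Icc (1 : ℤ) n
      · simp only [G, dif_pos h1, dif_pos h2] at h
        have := g.injective (Subtype.ext h)
        exact congrArg Subtype.val this
      · have a := Finset.mem_Icc.1 h1
        rw [Finset.mem_Icc] at h2
        have := Gr x a.1 a.2
        by_cases hy0 : y = 0
        · subst hy0; omega
        · have := Gn y (by omega); omega
    · by_cases h2 : y ∈ Finset.Icc (1 : ℤ) n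
      · have a := Finset.mem_Icc.1 h2
        rw [Finset.mem_Icc] at h1
        have := Gr y a.1 a.2
        by_cases hy0 : x = 0
        · subst hy0; omega
        · have := Gn x (by omega); omega
      · simpa only [G, dif_neg h1, dif_neg h2] using h
  let f : ℤ → ℤ := fun x => if x ∈ U then t x else if 0 ≤ x then G x else -G (-x)
  have fabs : ∀ x, |f x| = G |x| := by
    intro x
    have Gnn : ∀ y, 0 ≤ y → 0 ≤ G y := by
      intro y hy
      by_cases h1 : y = 0
      · rw [h1, G0]
      by_cases h2 : y ≤ n
      · have := Gr y (by omega) h2; omega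
      · rw [Gn y (by omega)]; exact hy
    by_cases hx : x ∈ U
    · simp only [f, if_pos hx]
      have b := hU x hx
      rcases abs_cases x with ⟨h, _⟩ | ⟨h, _⟩
      · rw [h] at b ⊢; rw [Gt x hx b.1 b.2]
      · rw [h] at b ⊢; rw [Gt (-x) (hUneg x hx) b.1 b.2, hodd, abs_neg]
    · simp only [f, if_neg hx]
      split_ifs with h
      · rw [abs_of_nonneg h, abs_of_nonneg (Gnn x h)]
      · rw [abs_of_neg (not_le.1 h), abs_neg, abs_of_nonneg (Gnn _ (by omega))]
  have fodd : ∀ x, f (-x) = -f x := by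
    intro x
    by_cases hx : x ∈ U
    · simp only [f, if_pos hx, if_pos (hUneg x hx), hodd]
    · have hx' : -x ∉ U := fun h => hx (by simpa using hUneg _ h)
      simp only [f, if_neg hx, if_neg hx']
      rcases lt_trichotomy x 0 with h | h | h
      · rw [if_pos (by omega), if_neg (by omega), neg_neg]
      · subst h; simp [G0]
      · rw [if_neg (by omega), if_pos (by omega), neg_neg]
  refine ⟨f, ?_, fodd, ?_, fun x hx => by simp only [f, if_pos hx]⟩
  · intro x y h
    have h' : |x| = |y| := by
      apply Gi _ _ (abs_nonneg _) (abs_nonneg _)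
      rw [← fabs, ← fabs, h]
    rcases abs_eq_abs.1 h' with h' | h'
    · exact h'
    · subst h'
      rw [fodd] at h
      have hz : f y = 0 := by omega
      have := fabs y
      rw [hz, abs_zero, ← G0] at this
      have := Gi _ _ le_rfl (abs_nonneg _) this
      have := abs_eq_zero.1 this.symm
      omega
  · intro x hx
    have hxU : x ∉ U := fun h => by have := hU x h; omega
    simp only [f, if_neg hxU]
    split_ifs with h
    · rw [abs_of_nonneg h] at hx; exact Gn x hx
    · rw [abs_of_neg (not_le.1 h)] at hx; rw [Gn _ hx, neg_neg]
end ArtinTits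

namespace ArtinTits

theorem refl_support {n j : ℕ} (h2 : 2 ≤ n) (hj : j < n) (x : ℤ) (h : refl j x ≠ x) :
    1 ≤ |x| ∧ |x| ≤ (n : ℤ) := by
  have key : x = 1 ∨ x = 2 ∨ x = -1 ∨ x = -2 ∨ (1 ≤ j ∧ (x = j ∨ x = j + 1 ∨ x = -j ∨ x = -(j + 1))) := by
    by_cases h0 : j = 0
    · subst h0
      rw [refl_zero] at h
      have := sgnSwap_spec 1 (-2) x
      omega
    · rw [refl_pos h0] at h
      have := sgnSwap_spec j (j + 1) x
      omega
  rcases abs_cases x with ⟨h, _⟩ | ⟨h, _⟩ <;> rw [h] <;> omega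

theorem DSys.core {G : Type*} [Group G] {m : ℕ} (D : DSys G m) {n : ℕ} (hno : Odd n) (h2 : 2 ≤ n)
    (hn : n < m) (J : Set ℕ) (hJ : ∀ j ∈ J, j < n) (w : G) (hwm : w ∈ D.H m)
    (htop : ∀ g : G, g ∈ D.H m)
    (hw : ∀ j ∈ J, ∃ j', j' < n ∧ w⁻¹ * D.s j * w = D.s j') :
    ∃ v ∈ D.H n, ∀ j ∈ J, v⁻¹ * D.s j * v = w⁻¹ * D.s j * w := by
  have i1 : ∀ x, D.ρ w (D.ρ w⁻¹ x) = x := by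
    intro y; rw [← Equiv.Perm.mul_apply, ← map_mul]; simp
  have i2 : ∀ x, D.ρ w⁻¹ (D.ρ w x) = x := by
    intro y; rw [← Equiv.Perm.mul_apply, ← map_mul]; simp
  -- the key intertwining relation
  have key : ∀ j ∈ J, ∀ j', j' < n → w⁻¹ * D.s j * w = D.s j' →
      ∀ x, D.ρ w⁻¹ (refl j x) = refl j' (D.ρ w⁻¹ x) := by
    intro j hj j' hj' e x
    have e' : w⁻¹ * D.s j = D.s j' * w⁻¹ := by rw [← e]; group
    have := congrArg (fun g => D.ρ g x) e'
    simp only [map_mul, Equiv.Perm.mul_apply] at this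
    rwa [D.hρ j (lt_trans (hJ j hj) hn), D.hρ j' (lt_trans hj' hn)] at this
  let U : Set ℤ := {x | ∃ j ∈ J, refl j x ≠ x}
  obtain ⟨f, finj, fodd, ffix, fU⟩ := extend_odd n U (D.ρ w⁻¹) (D.ρ w⁻¹).injective
    (D.ρ_neg (htop _))
    (by
      rintro x ⟨j, hj, h⟩
      refine ⟨j, hj, ?_⟩
      rw [refl_neg]
      omega)
    (by
      rintro x ⟨j, hj, h⟩
      exact refl_support h2 (hJ j hj) x h)
    (by
      rintro x ⟨j, hj, h⟩
      obtain ⟨j', hj', e⟩ := hw j hj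
      refine refl_support h2 hj' _ ?_
      rw [← key j hj j' hj' e]
      exact fun hc => h ((D.ρ w⁻¹).injective hc))
  obtain ⟨h, hh, hsgn⟩ := D.surj_odd hno hn.le f finj fodd ffix
  obtain ⟨δ, hδ, hρ⟩ : ∃ δ : ℤ, (δ = 1 ∨ δ = -1) ∧ ∀ x ∈ U, D.ρ h x = δ * D.ρ w⁻¹ x := by
    rcases hsgn with e | e
    · exact ⟨1, Or.inl rfl, fun x hx => by rw [← e, fU x hx, one_mul]⟩
    · refine ⟨-1, Or.inr rfl, fun x hx => ?_⟩
      have hx' : |x| ≤ (n : ℤ) := by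
        obtain ⟨j, hj, h⟩ := hx
        exact (refl_support h2 (hJ j hj) x h).2
      rw [← e x hx', fodd, fU x hx]; ring
  have rδ : ∀ i x, refl i (δ * x) = δ * refl i x := by
    intro i x
    rcases hδ with rfl | rfl
    · simp
    · simp [refl_neg]
  have ρδ : ∀ g x, D.ρ g (δ * x) = δ * D.ρ g x := by
    intro g x
    rcases hδ with rfl | rfl
    · simp
    · simp [D.ρ_neg (htop g)]
  have δδ : ∀ x, δ * (δ * x) = x := by
    intro x
    rcases hδ with rfl | rfl <;> simp
  refine ⟨h⁻¹, inv_mem hh, fun j hj => ?_⟩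
  obtain ⟨j', hj', e⟩ := hw j hj
  have K := key j hj j' hj' e
  have main : ∀ x, D.ρ h (refl j x) = refl j' (D.ρ h x) := by
    intro x
    by_cases hx : refl j x = x
    · rw [hx]
      by_contra hc
      obtain ⟨z, hz⟩ : ∃ z, z = D.ρ h x := ⟨_, rfl⟩
      rw [← hz] at hc
      have hy : refl j (D.ρ w z) ≠ D.ρ w z := by
        intro hc'
        have := K (D.ρ w z)
        rw [hc', i2] at this
        exact hc this
      have h1 := hρ (D.ρ w z) ⟨j, hj, hy⟩
      rw [i2] at h1
      have h3 : D.ρ h (δ * D.ρ w z) = D.ρ h x := by rw [ρδ, h1, δδ, hz]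
      have h4 := (D.ρ h).injective h3
      rw [← h4, rδ] at hx
      apply hy
      rw [← δδ (refl j (D.ρ w z)), hx, δδ]
    · rw [hρ x ⟨j, hj, hx⟩, hρ (refl j x) ⟨j, hj, by
        rw [refl_refl]; exact fun h => hx h.symm⟩, K, rδ]
  rw [inv_inv, e]
  have : h * D.s j * h⁻¹ * (D.s j')⁻¹ = 1 := by
    apply D.faithful (k := m) (by omega) le_rfl (htop _)
    have : D.ρ (h * D.s j) = D.ρ (D.s j' * h) := by
      ext x
      simp only [map_mul, Equiv.Perm.mul_apply]
      rw [D.hρ j (lt_trans (hJ j hj) hn), D.hρ j' (lt_trans hj' hn), main]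
    rw [mul_assoc, map_mul, this, ← map_mul]
    simp
  exact mul_inv_eq_one.1 this

theorem pow_three_of_braid {G : Type*} [Group G] {a b : G} (ha : a * a = 1) (hb : b * b = 1)
    (h : a * b * a = b * a * b) : (a * b) ^ 3 = 1 := by
  calc (a * b) ^ 3 = (a * b * a) * (b * a * b) := by simp [pow_succ, mul_assoc]
    _ = (a * b * a) * (a * b * a) := by rw [h]
    _ = a * (b * (a * a) * b) * a := by simp only [mul_assoc]
    _ = 1 := by rw [ha, mul_one, hb, mul_one, ha]

theorem braid_of_pow_three {G : Type*} [Group G] {a b : G} (ha : a * a = 1) (hb : b * b = 1)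
    (h : (a * b) ^ 3 = 1) : a * b * a = b * a * b := by
  have ha' : a⁻¹ = a := inv_eq_of_mul_eq_one_left ha
  have hb' : b⁻¹ = b := inv_eq_of_mul_eq_one_left hb
  have h1 : (a * b * a) * (b * a * b) = 1 := by rw [← h]; simp [pow_succ, mul_assoc]
  rw [eq_inv_of_mul_eq_one_left h1]
  simp [ha', hb', mul_assoc]

theorem pow_two_of_comm {G : Type*} [Group G] {a b : G} (ha : a * a = 1) (hb : b * b = 1)
    (h : a * b = b * a) : (a * b) ^ 2 = 1 := by
  rw [pow_two]
  nth_rw 2 [h]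
  rw [mul_assoc, ← mul_assoc b, hb, one_mul, ha]

theorem comm_of_pow_two {G : Type*} [Group G] {a b : G} (ha : a * a = 1) (hb : b * b = 1)
    (h : (a * b) ^ 2 = 1) : a * b = b * a := by
  have ha' : a⁻¹ = a := inv_eq_of_mul_eq_one_left ha
  have hb' : b⁻¹ = b := inv_eq_of_mul_eq_one_left hb
  rw [pow_two] at h
  rw [eq_inv_of_mul_eq_one_left h, mul_inv_rev, ha', hb']

theorem Dmat_def (n : ℕ) (i j : Fin n) : Dmat n i j = if i = j then 1
      else (if (i.val = 0 ∧ j.val = 2) ∨ (j.val = 0 ∧ i.val = 2) then 3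
        else (if i.val = 0 ∨ j.val = 0 then 2
          else (if (j : ℕ) + 1 = i ∨ (i : ℕ) + 1 = j then 3 else 2))) := rfl

theorem Dmat_adj {n : ℕ} {i j : Fin n} (h : DAdj i j) : Dmat n i j = 3 := by
  unfold DAdj at h
  rw [Dmat_def]
  simp only [Fin.ext_iff]
  split_ifs <;> omega

theorem Dmat_nadj {n : ℕ} {i j : Fin n} (hij : i < j) (h : ¬ DAdj i j) : Dmat n i j = 2 := by
  unfold DAdj at h
  rw [Fin.lt_def] at hij
  rw [Dmat_def]
  simp only [Fin.ext_iff]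
  split_ifs <;> omega

theorem Dmat_eq_three {n : ℕ} {i j : Fin n} : Dmat n i j = 3 ↔ DAdj i j ∨ DAdj j i := by
  unfold DAdj
  rw [Dmat_def]
  simp only [Fin.ext_iff]
  split_ifs <;> omega

theorem reflPerm_sq (i : ℕ) : reflPerm i * reflPerm i = 1 := by
  ext x; simp [refl_refl]

theorem reflPerm_pow {n : ℕ} (i j : Fin n) :
    (reflPerm i * reflPerm j) ^ (Dmat n i j) = 1 := by
  have main : ∀ i j : Fin n, i < j → (reflPerm i * reflPerm j) ^ (Dmat n i j) = 1 := by
    intro i j hij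
    by_cases h : DAdj i j
    · rw [Dmat_adj h]
      exact pow_three_of_braid (reflPerm_sq _) (reflPerm_sq _) (by
        ext x; simpa using refl_braid h x)
    · rw [Dmat_nadj hij h]
      exact pow_two_of_comm (reflPerm_sq _) (reflPerm_sq _) (by
        ext x; simpa using refl_comm (Fin.lt_def.1 hij) h x)
  rcases lt_trichotomy i j with h | h | h
  · exact main i j h
  · subst h; simp [reflPerm_sq]
  · have := main j i h
    rw [(Dmat n).symmetric i j]
    rw [← inv_inj, ← inv_pow, mul_inv_rev, inv_one,
      inv_eq_of_mul_eq_one_left (reflPerm_sq _), inv_eq_of_mul_eq_one_left (reflPerm_sq _)]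
    exact this

/-- The standard system attached to a Coxeter matrix of type `D_m`. -/
theorem exists_DSys {B : Type*} (M : CoxeterMatrix B) (m : ℕ) (e : B ≃ Fin m)
    (he : ∀ a b, M a b = Dmat m (e a) (e b)) :
    ∃ D : DSys M.Group m, ∀ b, D.s (e b) = M.simple b := by
  classical
  let cs := M.toCoxeterSystem
  have hcs : ∀ b, cs.simple b = M.simple b := fun b => rfl
  have hl : M.IsLiftable (fun b => reflPerm (e b)) := by
    intro a b
    rw [he]
    exact reflPerm_pow _ _
  let s : ℕ → M.Group := fun k => if h : k < m then M.simple (e.symm ⟨k, h⟩) else 1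
  have hs : ∀ k (h : k < m), s k = M.simple (e.symm ⟨k, h⟩) := fun k h => by simp only [s, dif_pos h]
  have hsq : ∀ i, i < m → s i * s i = 1 := by
    intro i hi
    rw [hs i hi]
    exact cs.simple_mul_simple_self _
  have hpow : ∀ i j (hi : i < m) (hj : j < m), (s i * s j) ^ (Dmat m ⟨i, hi⟩ ⟨j, hj⟩) = 1 := by
    intro i j hi hj
    have := cs.simple_mul_simple_pow (e.symm ⟨i, hi⟩) (e.symm ⟨j, hj⟩)
    rw [he, e.apply_symm_apply, e.apply_symm_apply] at this
    rw [hs i hi, hs j hj]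
    exact this
  refine ⟨⟨s, cs.lift ⟨_, hl⟩, hsq, ?_, ?_, ?_⟩, ?_⟩
  · intro i j hij hj ha
    have := hpow i j (hij.trans hj) hj
    rw [Dmat_nadj (Fin.lt_def.2 hij) ha] at this
    exact comm_of_pow_two (hsq _ (hij.trans hj)) (hsq _ hj) this
  · intro i j ha hj
    have hij : i < j := by unfold DAdj at ha; omega
    have := hpow i j (hij.trans hj) hj
    rw [Dmat_adj ha] at this
    exact braid_of_pow_three (hsq _ (hij.trans hj)) (hsq _ hj) this
  · intro i hi x
    rw [hs i hi, ← hcs, cs.lift_apply_simple hl]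
    simp
  · intro b
    change s (e b) = _
    rw [hs _ (e b).2]
    simp

/-- A subdiagram of type `D_n` (`n ≥ 5`) of the diagram `D_m` consists of the first `n` vertices. -/
theorem embed_range {n m : ℕ} (hn : 5 ≤ n) (φ : Fin n → Fin m) (hφ : Function.Injective φ)
    (h : ∀ i j, Dmat n i j = Dmat m (φ i) (φ j)) (k : Fin m) : (∃ i, φ i = k) ↔ k.val < n := by
  have hadj : ∀ i j : Fin n, DAdj i j ∨ DAdj j i ↔ DAdj (φ i) (φ j) ∨ DAdj (φ j) (φ i) := by
    intro i j
    rw [← Dmat_eq_three, ← Dmat_eq_three, h]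
  have hinj : ∀ i j : Fin n, (φ i).val = (φ j).val → i.val = j.val := by
    intro i j e
    rw [hφ (Fin.ext e)]
  simp only [DAdj] at hadj
  let v : ℕ → ℕ := fun i => if hi : i < n then (φ ⟨i, hi⟩).val else 0
  have hv : ∀ i (hi : i < n), v i = (φ ⟨i, hi⟩).val := fun i hi => by simp only [v, dif_pos hi]
  have A : ∀ i j, i < n → j < n →
      (((i = 0 ∧ j = 2) ∨ (1 ≤ i ∧ j = i + 1)) ∨ ((j = 0 ∧ i = 2) ∨ (1 ≤ j ∧ i = j + 1)) ↔
      ((v i = 0 ∧ v j = 2) ∨ (1 ≤ v i ∧ v j = v i + 1)) ∨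
        ((v j = 0 ∧ v i = 2) ∨ (1 ≤ v j ∧ v i = v j + 1))) := by
    intro i j hi hj
    rw [hv i hi, hv j hj]
    exact hadj ⟨i, hi⟩ ⟨j, hj⟩
  have I : ∀ i j, i < n → j < n → v i = v j → i = j := by
    intro i j hi hj e
    rw [hv i hi, hv j hj] at e
    exact hinj ⟨i, hi⟩ ⟨j, hj⟩ e
  clear hadj hinj
  have a02 := (A 0 2 (by omega) (by omega)).1 (by omega)
  have a12 := (A 1 2 (by omega) (by omega)).1 (by omega)
  have a32 := (A 3 2 (by omega) (by omega)).1 (by omega)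
  have a34 := (A 3 4 (by omega) (by omega)).1 (by omega)
  have i01 : v 0 ≠ v 1 := fun e => absurd (I 0 1 (by omega) (by omega) e) (by omega)
  have i03 : v 0 ≠ v 3 := fun e => absurd (I 0 3 (by omega) (by omega) e) (by omega)
  have i13 : v 1 ≠ v 3 := fun e => absurd (I 1 3 (by omega) (by omega) e) (by omega)
  have i24 : v 2 ≠ v 4 := fun e => absurd (I 2 4 (by omega) (by omega) e) (by omega)
  have v2 : v 2 = 2 := by omega
  have v3 : v 3 = 3 := by omega
  have v01 : (v 0 = 0 ∧ v 1 = 1) ∨ (v 0 = 1 ∧ v 1 = 0) := by omega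
  have vk : ∀ i, 2 ≤ i → i + 1 < n → v i = i ∧ v (i + 1) = i + 1 := by
    intro i hi
    induction i, hi using Nat.le_induction with
    | base => intro _; exact ⟨v2, v3⟩
    | succ i hi ih =>
      intro hin
      obtain ⟨b1, b2⟩ := ih (by omega)
      refine ⟨b2, ?_⟩
      have a := (A (i + 1) (i + 1 + 1) (by omega) (by omega)).1 (by omega)
      have i' : v i ≠ v (i + 1 + 1) := fun e => absurd (I _ _ (by omega) (by omega) e) (by omega)
      omega
  have vk' : ∀ i, 2 ≤ i → i < n → v i = i := by
    intro i h1 h2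
    by_cases c : i = 2
    · rw [c, v2]
    · have := (vk (i - 1) (by omega) (by omega)).2
      rwa [show i - 1 + 1 = i by omega] at this
  constructor
  · rintro ⟨i, rfl⟩
    have := hv i.val i.2
    rw [← this]
    by_cases c : 2 ≤ i.val
    · rw [vk' _ c i.2]; exact i.2
    · obtain c | c : i.val = 0 ∨ i.val = 1 := by omega
      · rw [c]; omega
      · rw [c]; omega
  · intro hk
    obtain ⟨i, hi, e⟩ : ∃ i, i < n ∧ v i = k.val := by
      by_cases c : 2 ≤ k.val
      · exact ⟨k.val, hk, vk' _ c hk⟩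
      · rcases v01 with ⟨c1, c2⟩ | ⟨c1, c2⟩
        · by_cases c0 : k.val = 0
          · exact ⟨0, by omega, by omega⟩
          · exact ⟨1, by omega, by omega⟩
        · by_cases c0 : k.val = 0
          · exact ⟨1, by omega, by omega⟩
          · exact ⟨0, by omega, by omega⟩
    exact ⟨⟨i, hi⟩, Fin.ext (by rw [← hv i hi, e])⟩

/-- Lemma 3 of the paper, second case: if `W_S` is of type `D_m` and `W_X` is of type `D_n`
with `n` odd and `n < m`, then `(W_X, W_S)` satisfies Property `⋆_W`. -/
theorem starW_of_type_D_odd_in_D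
    {B : Type*} [Finite B] (M : CoxeterMatrix B)
    (m n : ℕ) (hm : IsOfType M Set.univ (Dmat m))
    (X : Set B) (hXtype : IsOfType M X (Dmat n))
    (hn4 : 4 ≤ n) (hodd : Odd n) (hnm : n < m) :
    StarW M X := by
  obtain ⟨e0, he0⟩ := hm
  let e : B ≃ Fin m := (Equiv.Set.univ B).symm.trans e0
  have he : ∀ a b, M a b = Dmat m (e a) (e b) := fun a b => he0 ⟨a, trivial⟩ ⟨b, trivial⟩
  obtain ⟨e', he'⟩ := hXtype
  have hn5 : 5 ≤ n := by
    obtain ⟨k, rfl⟩ := hodd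
    omega
  have hX : ∀ b, b ∈ X ↔ (e b).val < n := by
    intro b
    rw [← embed_range hn5 (fun i => e (e'.symm i).val)
      (fun i j hij => e'.symm.injective (Subtype.ext (e.injective hij)))
      (fun i j => by rw [← he, he', e'.apply_symm_apply, e'.apply_symm_apply]) (e b)]
    constructor
    · intro hb
      exact ⟨e' ⟨b, hb⟩, by simp⟩
    · rintro ⟨i, hi⟩
      rw [← e.injective hi]
      exact (e'.symm i).2
  obtain ⟨D, hD⟩ := exists_DSys M m e he
  have hHn : D.H n = WP M X := by
    unfold DSys.H WP
    congr 1
    ext g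
    constructor
    · rintro ⟨j, hj, rfl⟩
      have hj' : j < n := hj
      refine ⟨e.symm ⟨j, hj'.trans hnm⟩, (hX _).2 (by simpa using hj'), ?_⟩
      rw [← hD]; simp
    · rintro ⟨b, hb, rfl⟩
      exact ⟨e b, (hX b).1 hb, hD b⟩
  have htop : ∀ g, g ∈ D.H m := by
    intro g
    have h1 : Subgroup.closure (Set.range M.simple) ≤ D.H m := by
      rw [Subgroup.closure_le]
      rintro _ ⟨b, rfl⟩
      rw [← hD b]
      exact D.s_mem (e b).2
    have h2 : Subgroup.closure (Set.range M.simple) = ⊤ :=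
      M.toCoxeterSystem.subgroup_closure_range_simple
    rw [h2] at h1
    exact h1 trivial
  intro Y₁ Y₂ h1 h2 w hw
  obtain ⟨v, hv, hvw⟩ := D.core hodd (by omega) hnm {j | ∃ b ∈ Y₁, (e b).val = j}
    (by rintro _ ⟨b, hb, rfl⟩; exact (hX b).1 (h1 hb)) w (htop w) htop (by
      rintro _ ⟨b, hb, rfl⟩
      have : w⁻¹ * M.simple b * w ∈ M.simple '' Y₂ := by
        rw [← hw]
        exact ⟨_, ⟨b, hb, rfl⟩, rfl⟩
      obtain ⟨c, hc, hce⟩ := this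
      exact ⟨e c, (hX c).1 (h2 hc), by rw [hD, hD, hce]⟩)
  refine ⟨v, hHn ▸ hv, fun y hy => ?_⟩
  rw [← hD y]
  exact hvw _ ⟨y, hy, rfl⟩

end ArtinTits
end

section
/- Let A_S be an Artin-Tits group of spherical type. Let g, h be positive elements of A_S with Supp(g) = Y and Supp(h) = Z, where Y and Z are proper subsets of S. If g and h are conjugate in A_S, then there exist n ≥ 0, subsets Y = Y_0, Y_1, …, Y_n = Z of S, and elements t_1, …, t_n of S with t_i adjacent to Y_{i−1}, such that for each i the adjacent ribbon r(t_i, Y_{i−1}) satisfies r(t_i,Y_{i−1})⁻¹ Σ_{Y_{i−1}} r(t_i,Y_{i−1}) = Σ_{Y_i}. -/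
namespace ArtinTits

variable {B : Type*}

/-- `w` is a longest element of the standard parabolic subgroup `W_X` of the Coxeter group. -/
def IsLongestIn (M : CoxeterMatrix B) (X : Set B) (w : M.Group) : Prop :=
  w ∈ WP M X ∧ ∀ v ∈ WP M X, M.toCoxeterSystem.length v ≤ M.toCoxeterSystem.length w

/-- `d` is the element `Δ_X` of the Artin–Tits group: the image under the section `τ` of the
longest element of `W_X`, i.e. the product `σ_{i_1} ⋯ σ_{i_l}` for some (any) reduced expression
`s_{i_1} ⋯ s_{i_l}` of the longest element of `W_X`. -/
def IsDeltaOf (M : CoxeterMatrix B) (X : Set B) (d : ArtinGroup M) : Prop :=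
  ∃ l : List B, (∀ b ∈ l, b ∈ X) ∧ M.toCoxeterSystem.IsReduced l ∧
    IsLongestIn M X (M.toCoxeterSystem.wordProd l) ∧ d = (l.map (σ M)).prod

/-- An element of an Artin–Tits group is positive if it is a product of standard generators. -/
def IsPositive (M : CoxeterMatrix B) (g : ArtinGroup M) : Prop :=
  ∃ l : List B, g = (l.map (σ M)).prod

/-- The support of a positive element: the letters appearing in every positive word
representing it. -/
def Supp (M : CoxeterMatrix B) (g : ArtinGroup M) : Set B :=
  {s | ∀ l : List B, (l.map (σ M)).prod = g → s ∈ l}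

set_option linter.unusedSectionVars false
section Helpers
open Matrix

/-! ### Alternating products -/

theorem altProd_map {G H : Type*} [Monoid G] [Monoid H] (f : G →* H) (n : ℕ) :
    ∀ a b : G, f (altProd a b n) = altProd (f a) (f b) n := by
  induction n with
  | zero => intro a b; simp [altProd]
  | succ n ih => intro a b; simp [altProd, ih]

theorem altProd_eq_pow_mul {G : Type*} [Monoid G] (n : ℕ) :
    ∀ a b : G, a * a = 1 → b * b = 1 → altProd a b n = (a * b) ^ n * altProd b a n := by
  induction n with
  | zero => intro a b _ _; simp [altProd]
  | succ n ih =>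
    intro a b ha hb
    have key : ∀ k : ℕ, a * (b * a) ^ k = (a * b) ^ k * a := by
      intro k
      induction k with
      | zero => simp
      | succ k ihk => rw [pow_succ', pow_succ', mul_assoc (a * b), ← ihk]; simp only [mul_assoc]
    have h1 := ih b a hb ha
    calc altProd a b (n + 1) = a * altProd b a n := rfl
      _ = a * ((b * a) ^ n * altProd a b n) := by rw [h1]
      _ = (a * b) ^ n * a * altProd a b n := by rw [← mul_assoc, key]
      _ = (a * b) ^ n * a * (b * b) * altProd a b n := by rw [hb, mul_one]
      _ = (a * b) ^ (n + 1) * (b * altProd a b n) := by rw [pow_succ]; simp only [mul_assoc]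
      _ = _ := rfl

theorem altProd_inv_rev {G : Type*} [Monoid G] (n : ℕ) :
    ∀ a b : G, a * a = 1 → b * b = 1 → ∃ c : G, altProd a b n * c = 1 := by
  induction n with
  | zero => intro a b _ _; exact ⟨1, by simp [altProd]⟩
  | succ n ih =>
    intro a b ha hb
    obtain ⟨c, hc⟩ := ih b a hb ha
    refine ⟨c * a, ?_⟩
    calc a * altProd b a n * (c * a) = a * (altProd b a n * c) * a := by simp only [mul_assoc]
      _ = 1 := by rw [hc, mul_one, ha]

theorem pow_eq_one_of_altProd {G : Type*} [Monoid G] {a b : G} (n : ℕ) (ha : a * a = 1)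
    (hb : b * b = 1) (h : altProd a b n = altProd b a n) : (a * b) ^ n = 1 := by
  obtain ⟨c, hc⟩ := altProd_inv_rev n b a hb ha
  have h1 := altProd_eq_pow_mul n a b ha hb
  calc (a * b) ^ n = (a * b) ^ n * (altProd b a n * c) := by rw [hc, mul_one]
    _ = altProd a b n * c := by rw [← mul_assoc, ← h1]
    _ = 1 := by rw [h, hc]

theorem altProd_eq_of_pow {G : Type*} [Monoid G] {a b : G} (n : ℕ) (ha : a * a = 1)
    (hb : b * b = 1) (h : (a * b) ^ n = 1) : altProd a b n = altProd b a n := by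
  rw [altProd_eq_pow_mul n a b ha hb, h, one_mul]

/-! ### The braid relation for two rank-one perturbations of the identity -/

theorem braid_coeffs {A : Type*} [Ring A] [Algebra ℝ A] (E F K L : A) (p θ : ℝ)
    (hEE : E * E = (1 + p ^ 2) • E) (hEF : E * F = (-2 * p * Real.cos θ) • K)
    (hEK : E * K = (1 + p ^ 2) • K) (hEL : E * L = (-2 * p * Real.cos θ) • E)
    (hFF : F * F = (1 + p ^ 2) • F) (hFE : F * E = (-2 * p * Real.cos θ) • L)
    (hFL : F * L = (1 + p ^ 2) • L) (hFK : F * K = (-2 * p * Real.cos θ) • F) (n : ℕ) :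
    ∃ α α' γ γ' : ℝ,
      altProd (1 - E) (1 - F) n = 1 + α • E + α' • F + γ • K + γ' • L ∧
      altProd (1 - F) (1 - E) n = 1 + α • F + α' • E + γ • L + γ' • K ∧
      p * Real.sin θ * (α - α' + (γ - γ')) = - p ^ n * Real.sin (n * θ) ∧
      p * Real.sin θ * (α - α' - (γ - γ')) = (- p) ^ n * Real.sin (n * θ) ∧
      Real.sin θ * ((-1 - p ^ 2 * α' + 2 * p * Real.cos θ * γ - α) +
        (2 * p * Real.cos θ * α - p ^ 2 * γ' - γ)) = - p ^ n * Real.sin ((n + 1) * θ) ∧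
      Real.sin θ * ((-1 - p ^ 2 * α' + 2 * p * Real.cos θ * γ - α) -
        (2 * p * Real.cos θ * α - p ^ 2 * γ' - γ)) = - (- p) ^ n * Real.sin ((n + 1) * θ) := by
  induction n with
  | zero =>
    exact ⟨0, 0, 0, 0, by simp [altProd], by simp [altProd], by simp, by simp, by simp, by simp⟩
  | succ n ih =>
    obtain ⟨α, α', γ, γ', h1, h2, h3, h4, h5, h6⟩ := ih
    have hs : Real.sin ((n + 1 + 1) * θ) =
        2 * Real.cos θ * Real.sin ((n + 1) * θ) - Real.sin (n * θ) := by
      have e1 : ((n : ℝ) + 1 + 1) * θ = (n + 1) * θ + θ := by ring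
      have e2 : (n : ℝ) * θ = (n + 1) * θ - θ := by ring
      rw [e1, e2, Real.sin_add, Real.sin_sub]; ring
    refine ⟨-1 - p ^ 2 * α' + 2 * p * Real.cos θ * γ, α,
      2 * p * Real.cos θ * α - p ^ 2 * γ', γ, ?_, ?_, ?_, ?_, ?_, ?_⟩
    · rw [altProd, h2]
      simp only [sub_mul, mul_add, mul_one, one_mul, mul_smul_comm, hEE, hEF, hEK, hEL]
      module
    · rw [altProd, h1]
      simp only [sub_mul, mul_add, mul_one, one_mul, mul_smul_comm, hFF, hFE, hFK, hFL]
      module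
    · push_cast; linear_combination p * h5
    · push_cast; linear_combination p * h6
    · push_cast; rw [hs]; linear_combination 2 * p * Real.cos θ * h5 - p * h3
    · push_cast; rw [hs]; linear_combination -2 * p * Real.cos θ * h6 - p * h4

theorem braid_of_rank_one {A : Type*} [Ring A] [Algebra ℝ A] (E F K L : A) (p : ℝ) (m : ℕ)
    (hp : p ≠ 0) (hm : 2 ≤ m)
    (hEE : E * E = (1 + p ^ 2) • E) (hEF : E * F = (-2 * p * Real.cos (Real.pi / m)) • K)
    (hEK : E * K = (1 + p ^ 2) • K) (hEL : E * L = (-2 * p * Real.cos (Real.pi / m)) • E)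
    (hFF : F * F = (1 + p ^ 2) • F) (hFE : F * E = (-2 * p * Real.cos (Real.pi / m)) • L)
    (hFL : F * L = (1 + p ^ 2) • L) (hFK : F * K = (-2 * p * Real.cos (Real.pi / m)) • F) :
    altProd (1 - E) (1 - F) m = altProd (1 - F) (1 - E) m := by
  obtain ⟨α, α', γ, γ', h1, h2, h3, h4, -, -⟩ :=
    braid_coeffs E F K L p (Real.pi / m) hEE hEF hEK hEL hFF hFE hFL hFK m
  have hm0 : (m : ℝ) ≠ 0 := by positivity
  have hsin : Real.sin ((m : ℝ) * (Real.pi / m)) = 0 := by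
    rw [mul_div_cancel₀ _ hm0, Real.sin_pi]
  have hs : Real.sin (Real.pi / m) ≠ 0 := by
    apply ne_of_gt
    apply Real.sin_pos_of_pos_of_lt_pi
    · positivity
    · apply div_lt_self Real.pi_pos
      exact_mod_cast hm
  rw [hsin, mul_zero] at h3 h4
  have hps : p * Real.sin (Real.pi / m) ≠ 0 := mul_ne_zero hp hs
  have h3' := (mul_eq_zero.mp h3).resolve_left hps
  have h4' := (mul_eq_zero.mp h4).resolve_left hps
  have e1 : α = α' := by linarith
  have e2 : γ = γ' := by linarith
  rw [h1, h2, e1, e2]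
  abel

/-! ### The deformed reflection representation -/

section Rep
variable [Fintype B] [DecidableEq B] (M : CoxeterMatrix B)

/-- The (deformed) bilinear form, with parameter `p = exp x`. -/
noncomputable def bil (x : ℝ) : Matrix B B ℝ := fun s t =>
  if s = t then 1 + Real.exp x ^ 2 else -2 * Real.exp x * Real.cos (Real.pi / (M s t : ℝ))

theorem bil_self (x : ℝ) (s : B) : bil M x s s = 1 + Real.exp x ^ 2 := by simp [bil]

theorem bil_ne (x : ℝ) {s t : B} (h : s ≠ t) :
    bil M x s t = -2 * Real.exp x * Real.cos (Real.pi / (M s t : ℝ)) := by simp [bil, h]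

theorem bil_symm (x : ℝ) (s t : B) : bil M x s t = bil M x t s := by
  by_cases h : s = t
  · rw [h]
  · rw [bil_ne M x h, bil_ne M x (Ne.symm h), M.symmetric s t]

/-- The operator `T_s` of the deformed reflection representation. -/
noncomputable def Tm (x : ℝ) (s : B) : Matrix B B ℝ :=
  1 - vecMulVec (Pi.single s 1) (bil M x s)

theorem Tm_mulVec (x : ℝ) (s : B) (v : B → ℝ) :
    Tm M x s *ᵥ v = v - (bil M x s ⬝ᵥ v) • Pi.single s 1 := by
  rw [Tm, sub_mulVec, one_mulVec, vecMulVec_mulVec]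
  simp

theorem two_le_of_ne {s t : B} (h : s ≠ t) (h0 : M s t ≠ 0) : 2 ≤ M s t := by
  have := M.off_diagonal s t h
  have h1 : M s t ≠ 1 := this
  omega

theorem Tm_braid (x : ℝ) (s t : B) (h0 : M s t ≠ 0) :
    altProd (Tm M x s) (Tm M x t) (M s t) = altProd (Tm M x t) (Tm M x s) (M s t) := by
  by_cases hst : s = t
  · rw [hst]
  have hts : t ≠ s := Ne.symm hst
  refine braid_of_rank_one (vecMulVec (Pi.single s 1) (bil M x s))
    (vecMulVec (Pi.single t 1) (bil M x t)) (vecMulVec (Pi.single s 1) (bil M x t))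
    (vecMulVec (Pi.single t 1) (bil M x s)) (Real.exp x) (M s t) (Real.exp_pos x).ne'
    (two_le_of_ne M hst h0) ?_ ?_ ?_ ?_ ?_ ?_ ?_ ?_ <;>
  · rw [vecMulVec_mul_vecMulVec]
    simp [bil_self, bil_ne M x hst, bil_ne M x hts, M.symmetric t s, vecMulVec_smul]

theorem Tm_quad (x : ℝ) (s : B) :
    Tm M x s * Tm M x s = (1 - Real.exp x ^ 2) • Tm M x s + (Real.exp x ^ 2) • 1 := by
  have h : vecMulVec (Pi.single s (1 : ℝ)) (bil M x s) * vecMulVec (Pi.single s 1) (bil M x s)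
      = (1 + Real.exp x ^ 2) • vecMulVec (Pi.single s 1) (bil M x s) := by
    rw [vecMulVec_mul_vecMulVec]
    simp [bil_self, vecMulVec_smul]
  simp only [Tm, sub_mul, mul_sub, mul_one, one_mul, h]
  module

/-- The inverse of `T_s`. -/
noncomputable def Ti (x : ℝ) (s : B) : Matrix B B ℝ :=
  (Real.exp (-x) ^ 2) • (Tm M x s - (1 - Real.exp x ^ 2) • 1)

theorem exp_aux (x : ℝ) : Real.exp (-x) ^ 2 * Real.exp x ^ 2 = 1 := by
  rw [← mul_pow, ← Real.exp_add]; simp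

theorem Tm_mul_Ti (x : ℝ) (s : B) : Tm M x s * Ti M x s = 1 := by
  rw [Ti, mul_smul_comm, mul_sub, Tm_quad, mul_smul_comm, mul_one, add_sub_cancel_left, smul_smul,
    exp_aux, one_smul]

theorem Ti_mul_Tm (x : ℝ) (s : B) : Ti M x s * Tm M x s = 1 := by
  rw [Ti, smul_mul_assoc, sub_mul, Tm_quad, smul_mul_assoc, one_mul, add_sub_cancel_left, smul_smul,
    exp_aux, one_smul]

/-- `T_s` as a unit. -/
noncomputable def Tu (x : ℝ) (s : B) : (Matrix B B ℝ)ˣ :=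
  ⟨Tm M x s, Ti M x s, Tm_mul_Ti M x s, Ti_mul_Tm M x s⟩

/-- The deformed reflection representation of the Artin–Tits group. -/
noncomputable def rho (x : ℝ) : ArtinGroup M →* (Matrix B B ℝ)ˣ :=
  PresentedGroup.toGroup (f := Tu M x) (by
    rintro r ⟨s, t, h0, rfl⟩
    rw [map_mul, map_inv, mul_inv_eq_one, altProd_map, altProd_map]
    simp only [FreeGroup.lift_apply_of]
    apply Units.ext
    have h := Tm_braid M x s t h0
    have e := fun a b : (Matrix B B ℝ)ˣ => altProd_map (Units.coeHom (Matrix B B ℝ)) (M s t) a b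
    simp only [Units.coeHom_apply] at e
    rw [e, e]
    exact h)

theorem rho_sigma (x : ℝ) (s : B) : rho M x (σ M s) = Tu M x s := PresentedGroup.toGroup.of _

theorem Tm_zero_sq (s : B) : Tm M 0 s * Tm M 0 s = 1 := by
  rw [Tm_quad]; simp

/-- The reflection representation of the Coxeter group. -/
noncomputable def Rw : M.Group →* Matrix B B ℝ :=
  M.toCoxeterSystem.lift ⟨Tm M 0, by
    intro s t
    by_cases h0 : M s t = 0
    · rw [h0, pow_zero]
    · exact pow_eq_one_of_altProd _ (Tm_zero_sq M s) (Tm_zero_sq M t) (Tm_braid M 0 s t h0)⟩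

theorem Rw_simple (s : B) : Rw M (M.simple s) = Tm M 0 s :=
  M.toCoxeterSystem.lift_apply_simple _ s

theorem sigma_closure : Subgroup.closure (Set.range (σ M)) = ⊤ :=
  PresentedGroup.closure_range_of _

theorem exists_Rw_eq_rho (c : ArtinGroup M) :
    ∃ w : M.Group, Rw M w = (rho M 0 c : Matrix B B ℝ) := by
  have hc : c ∈ Subgroup.closure (Set.range (σ M)) := by rw [sigma_closure]; trivial
  induction hc using Subgroup.closure_induction with
  | mem y hy =>
    obtain ⟨s, rfl⟩ := hy
    exact ⟨M.simple s, by rw [Rw_simple, rho_sigma]; rfl⟩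
  | one => exact ⟨1, by simp⟩
  | mul a b _ _ ha hb =>
    obtain ⟨w, hw⟩ := ha
    obtain ⟨w', hw'⟩ := hb
    exact ⟨w * w', by rw [map_mul, map_mul, hw, hw', Units.val_mul]⟩
  | inv a _ ha =>
    obtain ⟨w, hw⟩ := ha
    refine ⟨w⁻¹, ?_⟩
    rw [map_inv (rho M 0)]
    apply Units.eq_inv_of_mul_eq_one_right
    rw [← hw, ← map_mul, inv_mul_cancel, map_one]

theorem rho_continuous (c : ArtinGroup M) :
    Continuous (fun x : ℝ => (rho M x c : Matrix B B ℝ)) := by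
  have hbil : Continuous (fun x : ℝ => bil M x) := by
    refine continuous_matrix fun s t => ?_
    unfold bil
    split_ifs <;> fun_prop
  have hT : ∀ s, Continuous (fun x : ℝ => Tm M x s) := by
    intro s
    unfold Tm
    refine Continuous.sub continuous_const ?_
    refine continuous_matrix fun a b => ?_
    simp only [vecMulVec_apply]
    refine continuous_const.mul ?_
    exact hbil.matrix_elem s b
  have hTi : ∀ s, Continuous (fun x : ℝ => Ti M x s) := by
    intro s
    unfold Ti
    have := hT s
    fun_prop
  have hc : c ∈ Subgroup.closure (Set.range (σ M)) := by rw [sigma_closure]; trivial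
  suffices h : Continuous (fun x : ℝ => (rho M x c : Matrix B B ℝ)) ∧
      Continuous (fun x : ℝ => ((rho M x c)⁻¹ : (Matrix B B ℝ)ˣ).val) from h.1
  induction hc using Subgroup.closure_induction with
  | mem y hy =>
    obtain ⟨s, rfl⟩ := hy
    simp only [rho_sigma]
    exact ⟨hT s, hTi s⟩
  | one => simp [continuous_const]
  | mul a b _ _ ha hb =>
    simp only [map_mul, _root_.mul_inv_rev, Units.val_mul]
    exact ⟨ha.1.mul hb.1, hb.2.mul ha.2⟩
  | inv a _ ha =>
    simp only [map_inv, inv_inv]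
    exact ⟨ha.2, ha.1⟩

end Rep

section PosDef
variable [Fintype B] [DecidableEq B] (M : CoxeterMatrix B)

/-- The basis vector `e_s`. -/
noncomputable def ev (s : B) : B → ℝ := Pi.single s 1

theorem ev_self (s : B) : ev s s = 1 := by simp [ev]

theorem ev_ne {s t : B} (h : t ≠ s) : ev s t = 0 := by simp [ev, h]

theorem ev_dotProduct (s : B) (v : B → ℝ) : ev s ⬝ᵥ v = v s := by simp [ev]

theorem dotProduct_ev (s : B) (v : B → ℝ) : v ⬝ᵥ ev s = v s := by simp [ev]

theorem mulVec_ev (A : Matrix B B ℝ) (s t : B) : (A *ᵥ ev s) t = A t s := by simp [ev]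

theorem Tm_mulVec' (x : ℝ) (s : B) (v : B → ℝ) :
    Tm M x s *ᵥ v = v - ((bil M x *ᵥ v) s) • ev s := Tm_mulVec M x s v

theorem bil_zero_self (s : B) : bil M 0 s s = 2 := by rw [bil_self]; norm_num

theorem Tm_zero_ev (s t : B) : Tm M 0 s *ᵥ ev t = ev t - (bil M 0 s t) • ev s := by
  rw [Tm_mulVec', mulVec_ev]

theorem bil_zero_posDef [Finite M.Group] (v : B → ℝ) (hv : v ≠ 0) :
    0 < v ⬝ᵥ (bil M 0 *ᵥ v) := by
  have := Fintype.ofFinite M.Group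
  set Hm : Matrix B B ℝ := ∑ w : M.Group, (Rw M w)ᵀ * Rw M w with hHm
  have hform : ∀ u v : B → ℝ, u ⬝ᵥ (Hm *ᵥ v) =
      ∑ w : M.Group, (Rw M w *ᵥ u) ⬝ᵥ (Rw M w *ᵥ v) := by
    intro u v
    rw [hHm, Matrix.sum_mulVec, dotProduct_sum]
    refine Finset.sum_congr rfl fun w _ => ?_
    rw [← mulVec_mulVec, dotProduct_mulVec, vecMul_transpose]
  have hpos : ∀ v : B → ℝ, v ≠ 0 → 0 < v ⬝ᵥ (Hm *ᵥ v) := by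
    intro v hv
    rw [hform]
    have hnn : ∀ u : B → ℝ, 0 ≤ u ⬝ᵥ u := fun u =>
      Finset.sum_nonneg fun i _ => mul_self_nonneg _
    refine Finset.sum_pos' (fun w _ => hnn _) ⟨1, Finset.mem_univ _, ?_⟩
    rw [map_one, one_mulVec]
    refine lt_of_le_of_ne (hnn v) fun h => hv ?_
    exact dotProduct_self_eq_zero.mp h.symm
  have hinv : ∀ (g : M.Group) (u v : B → ℝ),
      (Rw M g *ᵥ u) ⬝ᵥ (Hm *ᵥ (Rw M g *ᵥ v)) = u ⬝ᵥ (Hm *ᵥ v) := by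
    intro g u v
    rw [hform, hform]
    rw [← Equiv.sum_comp (Equiv.mulRight g)
      (fun w => (Rw M w *ᵥ u) ⬝ᵥ (Rw M w *ᵥ v))]
    refine Finset.sum_congr rfl fun w _ => ?_
    simp [map_mul, mulVec_mulVec]
  have hentry : ∀ s t, ev s ⬝ᵥ (Hm *ᵥ ev t) = Hm s t := by
    intro s t; rw [ev_dotProduct, mulVec_ev]
  have hsymm : ∀ s t, Hm s t = Hm t s := by
    intro s t
    rw [← hentry, ← hentry, hform, hform]
    exact Finset.sum_congr rfl fun w _ => dotProduct_comm _ _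
  have hrel : ∀ s t, 2 * Hm s t = bil M 0 s t * Hm s s := by
    intro s t
    have h := hinv (M.simple s) (ev s) (ev t)
    rw [Rw_simple, Tm_zero_ev, Tm_zero_ev, bil_zero_self] at h
    have e1 : ev s - (2 : ℝ) • ev s = - ev s := by module
    rw [e1, mulVec_sub, mulVec_smul, neg_dotProduct, dotProduct_sub, dotProduct_smul, hentry,
      hentry, smul_eq_mul] at h
    linarith
  have hdiag : ∀ s, 0 < Hm s s := by
    intro s
    rw [← hentry]
    apply hpos
    intro h
    have := congrFun h s
    rw [ev_self] at this
    simp at this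
  have hterm : ∀ s t, bil M 0 s t = 2 * Hm s t / (√(Hm s s) * √(Hm t t)) := by
    intro s t
    have hs := Real.sqrt_pos.mpr (hdiag s)
    have ht := Real.sqrt_pos.mpr (hdiag t)
    rw [eq_div_iff (mul_pos hs ht).ne', hrel]
    have h2 := hrel t s
    rw [hsymm t s, hrel s t, bil_symm M 0 t s] at h2
    by_cases h0 : bil M 0 s t = 0
    · rw [h0]; simp
    · have h3 : Hm s s = Hm t t := mul_left_cancel₀ h0 h2
      rw [← h3, Real.mul_self_sqrt (hdiag s).le]
  set v' : B → ℝ := fun s => v s / √(Hm s s) with hv'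
  have hv'0 : v' ≠ 0 := by
    intro h
    apply hv
    funext s
    have h1 := congrFun h s
    have hs := (Real.sqrt_pos.mpr (hdiag s)).ne'
    simp only [hv', Pi.zero_apply, div_eq_zero_iff, hs, or_false] at h1
    exact h1
  have hfin : v ⬝ᵥ (bil M 0 *ᵥ v) = 2 * (v' ⬝ᵥ (Hm *ᵥ v')) := by
    simp only [dotProduct, mulVec, Finset.mul_sum]
    refine Finset.sum_congr rfl fun s _ => Finset.sum_congr rfl fun t _ => ?_
    rw [hterm s t]
    simp only [hv']
    have hs := (Real.sqrt_pos.mpr (hdiag s)).ne'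
    have ht := (Real.sqrt_pos.mpr (hdiag t)).ne'
    field_simp
  rw [hfin]
  have := hpos v' hv'0
  linarith

theorem M_ne_zero [Finite M.Group] (s t : B) : M s t ≠ 0 := by
  intro h0
  by_cases hst : s = t
  · rw [hst, M.diagonal] at h0
    exact one_ne_zero h0
  have hne : ev s + ev t ≠ 0 := by
    intro h
    have h1 := congrFun h s
    simp only [Pi.add_apply, ev_self, ev_ne hst, Pi.zero_apply] at h1
    norm_num at h1
  have h := bil_zero_posDef M _ hne
  have hb : bil M 0 s t = -2 := by rw [bil_ne M 0 hst, h0]; simp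
  simp only [mulVec_add, add_dotProduct, dotProduct_add, ev_dotProduct, mulVec_ev, bil_zero_self,
    bil_symm M 0 t s, hb] at h
  norm_num at h

theorem bil_eq (x : ℝ) : bil M x = Real.exp x • bil M 0 + ((1 - Real.exp x) ^ 2) • 1 := by
  ext s t
  by_cases h : s = t
  · subst h
    simp [bil_self]; ring
  · simp [bil_ne M _ h, h]; ring

theorem bil_posDef [Finite M.Group] (x : ℝ) (v : B → ℝ) (hv : v ≠ 0) :
    0 < v ⬝ᵥ (bil M x *ᵥ v) := by
  rw [bil_eq, add_mulVec, smul_mulVec, smul_mulVec, one_mulVec, dotProduct_add, dotProduct_smul,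
    dotProduct_smul]
  have h1 := bil_zero_posDef M v hv
  have h2 : 0 ≤ v ⬝ᵥ v := Finset.sum_nonneg fun i _ => mul_self_nonneg _
  simp only [smul_eq_mul]
  positivity

theorem bil_isUnit [Finite M.Group] (x : ℝ) : IsUnit (bil M x).det := by
  rw [isUnit_iff_ne_zero]
  intro h
  obtain ⟨v, hv, hv2⟩ := Matrix.exists_mulVec_eq_zero_iff.mpr h
  have := bil_posDef M x v hv
  rw [hv2] at this
  simp at this

theorem bil_dot_symm (x : ℝ) (u v : B → ℝ) : u ⬝ᵥ (bil M x *ᵥ v) = v ⬝ᵥ (bil M x *ᵥ u) := by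
  have ht : (bil M x)ᵀ = bil M x := by ext s t; exact bil_symm M x t s
  rw [dotProduct_mulVec, ← mulVec_transpose, ht, dotProduct_comm]

end PosDef

section Limit
variable [Fintype B] [DecidableEq B] (M : CoxeterMatrix B)

/-- Contraction property of `T_s`. -/
theorem Tm_norm (x : ℝ) (s : B) (v : B → ℝ) :
    (Tm M x s *ᵥ v) ⬝ᵥ (bil M x *ᵥ (Tm M x s *ᵥ v)) =
      v ⬝ᵥ (bil M x *ᵥ v) - (1 - Real.exp x ^ 2) * ((bil M x *ᵥ v) s) ^ 2 := by
  have h1 : v ⬝ᵥ (bil M x *ᵥ ev s) = (bil M x *ᵥ v) s := by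
    rw [bil_dot_symm, ev_dotProduct]
  rw [Tm_mulVec', mulVec_sub, mulVec_smul, sub_dotProduct, dotProduct_sub, dotProduct_sub,
    dotProduct_smul, dotProduct_smul, smul_dotProduct, smul_dotProduct, h1, ev_dotProduct,
    ev_dotProduct, mulVec_ev, bil_self]
  simp only [smul_eq_mul]
  ring

theorem word_fixed_of (x : ℝ) (l : List B) (v : B → ℝ) (h : ∀ s ∈ l, (bil M x *ᵥ v) s = 0) :
    (l.map (Tm M x)).prod *ᵥ v = v := by
  induction l with
  | nil => simp
  | cons s l ih =>
    rw [List.map_cons, List.prod_cons, ← mulVec_mulVec,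
      ih (fun t ht => h t (List.mem_cons_of_mem _ ht)), Tm_mulVec', h s List.mem_cons_self]
    simp

theorem word_contract (x : ℝ) (hx : x < 0) (l : List B) (v : B → ℝ) :
    ((l.map (Tm M x)).prod *ᵥ v) ⬝ᵥ (bil M x *ᵥ ((l.map (Tm M x)).prod *ᵥ v)) ≤
      v ⬝ᵥ (bil M x *ᵥ v) ∧
    (((l.map (Tm M x)).prod *ᵥ v) ⬝ᵥ (bil M x *ᵥ ((l.map (Tm M x)).prod *ᵥ v)) =
      v ⬝ᵥ (bil M x *ᵥ v) → ∀ s ∈ l, (bil M x *ᵥ v) s = 0) := by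
  have hp : 0 < 1 - Real.exp x ^ 2 := by
    have h1 : Real.exp x < 1 := by rw [Real.exp_lt_one_iff]; exact hx
    have h0 := Real.exp_pos x
    nlinarith
  induction l with
  | nil => simp
  | cons s l ih =>
    rw [List.map_cons, List.prod_cons, ← mulVec_mulVec, Tm_norm]
    have h2 := mul_nonneg hp.le
      (sq_nonneg ((bil M x *ᵥ ((l.map (Tm M x)).prod *ᵥ v)) s))
    refine ⟨by linarith [ih.1], fun h => ?_⟩
    have h3 := ih.2 (by linarith [ih.1])
    have h4 := word_fixed_of M x l v h3
    rw [h4] at h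
    have h5 : (1 - Real.exp x ^ 2) * ((bil M x *ᵥ v) s) ^ 2 = 0 := by linarith
    have h6 := (mul_eq_zero.mp h5).resolve_left hp.ne'
    intro t ht
    rcases List.mem_cons.mp ht with rfl | ht
    · exact pow_eq_zero_iff (two_ne_zero) |>.mp h6
    · exact h3 t ht

theorem word_fixed_iff (x : ℝ) (hx : x < 0) (l : List B) (v : B → ℝ) :
    (l.map (Tm M x)).prod *ᵥ v = v ↔ ∀ s ∈ l, (bil M x *ᵥ v) s = 0 := by
  refine ⟨fun h => (word_contract M x hx l v).2 (by rw [h]), word_fixed_of M x l v⟩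

theorem rho_word (x : ℝ) (l : List B) :
    (rho M x ((l.map (σ M)).prod) : Matrix B B ℝ) = (l.map (Tm M x)).prod := by
  induction l with
  | nil => simp
  | cons s l ih =>
    simp only [List.map_cons, List.prod_cons, map_mul, Units.val_mul, ih, rho_sigma]
    rfl

/-- The vector `v` with prescribed values of the form. -/
theorem exists_bil_eq [Finite M.Group] (x : ℝ) (u : B → ℝ) : bil M x *ᵥ ((bil M x)⁻¹ *ᵥ u) = u := by
  rw [mulVec_mulVec, mul_nonsing_inv _ (bil_isUnit M x), one_mulVec]

theorem letters_subset [Finite M.Group] (l l' : List B)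
    (h : (l.map (σ M)).prod = (l'.map (σ M)).prod) : ∀ s ∈ l, s ∈ l' := by
  intro s hs
  by_contra hs'
  have hx : (-1 : ℝ) < 0 := by norm_num
  have h1 := (word_fixed_iff M (-1) hx l' ((bil M (-1))⁻¹ *ᵥ ev s)).mpr (by
    intro t ht
    rw [exists_bil_eq]
    exact ev_ne (fun h => hs' (h ▸ ht)))
  rw [← rho_word, ← h, rho_word] at h1
  have h2 := (word_fixed_iff M (-1) hx l _).mp h1 s hs
  rw [exists_bil_eq, ev_self] at h2
  exact one_ne_zero h2

theorem supp_word [Finite M.Group] (l : List B) :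
    Supp M ((l.map (σ M)).prod) = {s | s ∈ l} := by
  ext s
  constructor
  · intro h; exact h l rfl
  · intro h l' hl'
    exact letters_subset M l l' hl'.symm s h

theorem limit_aux [Finite M.Group] (l l' : List B) (c : ArtinGroup M)
    (h : (l.map (σ M)).prod * c = c * (l'.map (σ M)).prod) (v : B → ℝ)
    (hv : ∀ s ∈ l', (bil M 0 *ᵥ v) s = 0) :
    ∀ s ∈ l, (bil M 0 *ᵥ ((rho M 0 c : Matrix B B ℝ) *ᵥ v)) s = 0 := by
  intro s hs
  have hbil : Continuous (fun x : ℝ => bil M x) := by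
    refine continuous_matrix fun s t => ?_
    unfold bil
    split_ifs <;> fun_prop
  set u : ℝ → (B → ℝ) := fun x => (bil M x)⁻¹ *ᵥ (bil M 0 *ᵥ v) with hu
  have hu0 : u 0 = v := by
    simp only [hu]
    rw [mulVec_mulVec, nonsing_inv_mul _ (bil_isUnit M 0), one_mulVec]
  have hneg : ∀ x < 0, (bil M x *ᵥ ((rho M x c : Matrix B B ℝ) *ᵥ u x)) s = 0 := by
    intro x hx
    refine (word_fixed_iff M x hx l _).mp ?_ s hs
    have h1 : (l'.map (Tm M x)).prod *ᵥ u x = u x := by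
      apply word_fixed_of
      intro t ht
      simp only [hu]
      rw [exists_bil_eq]
      exact hv t ht
    rw [mulVec_mulVec, ← rho_word, ← Units.val_mul, ← map_mul, h, map_mul, Units.val_mul, rho_word,
      ← mulVec_mulVec, h1]
  have hucont : Continuous u := by
    refine Continuous.matrix_mulVec ?_ continuous_const
    have : (fun x : ℝ => (bil M x)⁻¹) = fun x => ((bil M x).det)⁻¹ • (bil M x).adjugate := by
      funext x
      rw [Matrix.inv_def, Ring.inverse_eq_inv']
    rw [this]
    have hd : Continuous (fun x : ℝ => ((bil M x).det)⁻¹) :=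
      hbil.matrix_det.inv₀ fun x => (bil_isUnit M x).ne_zero
    exact hd.smul hbil.matrix_adjugate
  have hcont : Continuous (fun x : ℝ => (bil M x *ᵥ ((rho M x c : Matrix B B ℝ) *ᵥ u x)) s) := by
    have := hbil.matrix_mulVec ((rho_continuous M c).matrix_mulVec hucont)
    exact (continuous_apply s).comp this
  have hlim := hcont.continuousWithinAt (s := Set.Iio (0 : ℝ)) (x := 0)
  have h2 := tendsto_nhds_unique hlim (tendsto_const_nhds.congr' (f₁ := fun _ => (0 : ℝ)) (by
    filter_upwards [self_mem_nhdsWithin] with x hx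
    exact (hneg x hx).symm))
  simp only [hu0] at h2
  exact h2

theorem Rw_inv_mulVec (w : M.Group) (v : B → ℝ) : Rw M w⁻¹ *ᵥ (Rw M w *ᵥ v) = v := by
  rw [mulVec_mulVec, ← map_mul, inv_mul_cancel, map_one, one_mulVec]

theorem Rw_mulVec_inv (w : M.Group) (v : B → ℝ) : Rw M w *ᵥ (Rw M w⁻¹ *ᵥ v) = v := by
  rw [mulVec_mulVec, ← map_mul, mul_inv_cancel, map_one, one_mulVec]

theorem Rw_mul_mulVec (w w' : M.Group) (v : B → ℝ) :
    Rw M (w * w') *ᵥ v = Rw M w *ᵥ (Rw M w' *ᵥ v) := by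
  rw [mulVec_mulVec, ← map_mul]

theorem Rw_invariant (w : M.Group) : ∀ (u v : B → ℝ),
    (Rw M w *ᵥ u) ⬝ᵥ (bil M 0 *ᵥ (Rw M w *ᵥ v)) = u ⬝ᵥ (bil M 0 *ᵥ v) := by
  refine M.toCoxeterSystem.simple_induction_left (p := fun w => ∀ (u v : B → ℝ),
    (Rw M w *ᵥ u) ⬝ᵥ (bil M 0 *ᵥ (Rw M w *ᵥ v)) = u ⬝ᵥ (bil M 0 *ᵥ v)) w ?_ ?_
  · intro u v; simp
  · intro w s ih u v
    rw [Rw_mul_mulVec, Rw_mul_mulVec, ← ih u v]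
    generalize Rw M w *ᵥ u = u'
    generalize Rw M w *ᵥ v = v'
    have h1 : u' ⬝ᵥ (bil M 0 *ᵥ ev s) = (bil M 0 *ᵥ u') s := by
      rw [bil_dot_symm, ev_dotProduct]
    rw [CoxeterMatrix.toCoxeterSystem_simple, Rw_simple, Tm_mulVec', Tm_mulVec', mulVec_sub,
      mulVec_smul, sub_dotProduct, dotProduct_sub, dotProduct_sub,
      dotProduct_smul, dotProduct_smul, smul_dotProduct, smul_dotProduct, h1, ev_dotProduct,
      ev_dotProduct, mulVec_ev, bil_zero_self]
    simp only [smul_eq_mul]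
    ring

/-- Vectors supported in `X`. -/
def InSpan (X : Set B) (v : B → ℝ) : Prop := ∀ s, s ∉ X → v s = 0

theorem span_of_perp [Finite M.Group] (Y Z : Set B) (w : M.Group)
    (h : ∀ v : B → ℝ, (∀ s ∈ Z, (bil M 0 *ᵥ v) s = 0) →
      ∀ s ∈ Y, (bil M 0 *ᵥ (Rw M w *ᵥ v)) s = 0) (u : B → ℝ) (hu : InSpan Y u) :
    InSpan Z (Rw M w⁻¹ *ᵥ u) := by
  intro s hs
  have h1 := h ((bil M 0)⁻¹ *ᵥ ev s) (by
    intro t ht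
    rw [exists_bil_eq]
    exact ev_ne (fun e => hs (e ▸ ht)))
  have h2 : u ⬝ᵥ (bil M 0 *ᵥ (Rw M w *ᵥ ((bil M 0)⁻¹ *ᵥ ev s))) = 0 := by
    refine Finset.sum_eq_zero fun t _ => ?_
    by_cases ht : t ∈ Y
    · rw [h1 t ht, mul_zero]
    · rw [hu t ht, zero_mul]
  rw [← Rw_invariant M w⁻¹, Rw_inv_mulVec, exists_bil_eq, dotProduct_ev] at h2
  exact h2

theorem exists_span_map [Finite M.Group] (l l' : List B) (c : ArtinGroup M)
    (h : c⁻¹ * (l.map (σ M)).prod * c = (l'.map (σ M)).prod) :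
    ∃ w : M.Group, (∀ u, InSpan {s | s ∈ l} u → InSpan {s | s ∈ l'} (Rw M w⁻¹ *ᵥ u)) ∧
      (∀ u, InSpan {s | s ∈ l'} u → InSpan {s | s ∈ l} (Rw M w *ᵥ u)) := by
  obtain ⟨w, hw⟩ := exists_Rw_eq_rho M c
  have hw' : Rw M w⁻¹ = (rho M 0 c⁻¹ : Matrix B B ℝ) := by
    rw [map_inv (rho M 0)]
    apply Units.eq_inv_of_mul_eq_one_right
    rw [← hw, ← map_mul, inv_mul_cancel, map_one]
  refine ⟨w, ?_, ?_⟩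
  · apply span_of_perp
    intro v hv
    rw [hw]
    exact limit_aux M l l' c (by rw [← h]; group) v hv
  · intro u hu
    have := span_of_perp M {s | s ∈ l'} {s | s ∈ l} w⁻¹ (by
      intro v hv
      rw [hw']
      exact limit_aux M l' l c⁻¹ (by rw [← h]; group) v hv) u hu
    rwa [inv_inv] at this

end Limit

section Tits
variable [Fintype B] [DecidableEq B] (M : CoxeterMatrix B)

/-- Alternating product of two simple reflections. -/
def altW (a b : B) (n : ℕ) : M.Group := altProd (M.simple a) (M.simple b) n

theorem altW_succ (a b : B) (n : ℕ) : altW M a b (n + 1) = M.simple a * altW M b a n := rfl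

theorem altW_zero (a b : B) : altW M a b 0 = 1 := rfl

theorem simple_sq' (s : B) : M.simple s * M.simple s = 1 :=
  M.toCoxeterSystem.simple_mul_simple_self s

theorem simple_inv' (s : B) : (M.simple s)⁻¹ = M.simple s :=
  M.toCoxeterSystem.inv_simple s

theorem length_altW_le (n : ℕ) : ∀ a b : B, M.toCoxeterSystem.length (altW M a b n) ≤ n := by
  induction n with
  | zero => intro a b; simp [altW_zero]
  | succ n ih =>
    intro a b
    rw [altW_succ]
    have h1 := M.toCoxeterSystem.length_mul_le (M.simple a) (altW M b a n)
    have h2 : M.toCoxeterSystem.length (M.simple a) = 1 := M.toCoxeterSystem.length_simple a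
    have h3 := ih b a
    omega

theorem altW_split (m : ℕ) : ∀ (a b : B) (k : ℕ), m ≤ k →
    ∃ x, altW M a b k = altW M a b m * x ∧ M.toCoxeterSystem.length x ≤ k - m := by
  induction m with
  | zero =>
    intro a b k _
    exact ⟨altW M a b k, by rw [altW_zero, one_mul], by simpa using length_altW_le M k a b⟩
  | succ m ih =>
    intro a b k hk
    obtain ⟨k, rfl⟩ : ∃ k', k = k' + 1 := ⟨k - 1, by omega⟩
    obtain ⟨x, hx, hx'⟩ := ih b a k (by omega)
    exact ⟨x, by rw [altW_succ, altW_succ, hx, mul_assoc], by omega⟩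

theorem altW_braid (a b : B) : altW M a b (M a b) = altW M b a (M a b) :=
  altProd_eq_of_pow _ (simple_sq' M a) (simple_sq' M b)
    (M.toCoxeterSystem.simple_mul_simple_pow a b)

theorem exists_decomp (n : ℕ) : ∀ (w : M.Group) (a b : B), M.toCoxeterSystem.length w = n →
    ¬ M.toCoxeterSystem.IsLeftDescent w b → ∃ k v, w = altW M a b k * v ∧
      M.toCoxeterSystem.length w = k + M.toCoxeterSystem.length v ∧
      ¬ M.toCoxeterSystem.IsLeftDescent v a ∧ ¬ M.toCoxeterSystem.IsLeftDescent v b := by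
  induction n with
  | zero =>
    intro w a b hw hb
    refine ⟨0, w, by simp [altW_zero], by simp, ?_, hb⟩
    intro h
    unfold CoxeterSystem.IsLeftDescent at h
    omega
  | succ n ih =>
    intro w a b hw hb
    by_cases ha : M.toCoxeterSystem.IsLeftDescent w a
    · have h1 := M.toCoxeterSystem.isLeftDescent_iff.mp ha
      have h2 := M.toCoxeterSystem.isLeftDescent_iff_not_isLeftDescent_mul.mp ha
      simp only [CoxeterMatrix.toCoxeterSystem_simple] at h1 h2
      obtain ⟨k, v, h3, h4, h5, h6⟩ := ih (M.simple a * w) b a (by omega) h2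
      refine ⟨k + 1, v, ?_, by omega, h6, h5⟩
      rw [altW_succ, mul_assoc, ← h3, ← mul_assoc, simple_sq', one_mul]
    · exact ⟨0, w, by simp [altW_zero], by simp, ha, hb⟩

/-- Nonnegative vectors. -/
def NN (v : B → ℝ) : Prop := ∀ s, 0 ≤ v s

theorem NN_add {u v : B → ℝ} (hu : NN u) (hv : NN v) : NN (u + v) :=
  fun s => add_nonneg (hu s) (hv s)

theorem NN_smul {r : ℝ} {v : B → ℝ} (hr : 0 ≤ r) (hv : NN v) : NN (r • v) :=
  fun s => mul_nonneg hr (hv s)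

theorem NN_ev (s : B) : NN (ev s) := by
  intro t
  by_cases h : t = s
  · rw [h, ev_self]; norm_num
  · rw [ev_ne h]

theorem ev_ne_zero (s : B) : ev s ≠ 0 := by
  intro h
  have := congrFun h s
  rw [ev_self] at this
  simp at this

theorem eq_zero_of_NN {v : B → ℝ} (h : NN v) (h' : NN (-v)) : v = 0 := by
  funext s
  have h1 := h s
  have h2 := h' s
  simp only [Pi.neg_apply] at h2
  simp only [Pi.zero_apply]
  linarith

theorem Rw_mulVec_ne_zero (w : M.Group) {v : B → ℝ} (hv : v ≠ 0) : Rw M w *ᵥ v ≠ 0 := by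
  intro h
  apply hv
  rw [← Rw_inv_mulVec M w v, h, mulVec_zero]

theorem sin_nonneg_aux (m j : ℕ) (h : j ≤ m) : 0 ≤ Real.sin (j * (Real.pi / m)) := by
  apply Real.sin_nonneg_of_nonneg_of_le_pi
  · have := Real.pi_pos; positivity
  · rcases Nat.eq_zero_or_pos m with rfl | hm
    · simp; exact Real.pi_pos.le
    · have hm' : (0 : ℝ) < m := by exact_mod_cast hm
      have hj : (j : ℝ) ≤ m := by exact_mod_cast h
      have hpi := Real.pi_pos
      calc (j : ℝ) * (Real.pi / m) ≤ m * (Real.pi / m) := by gcongr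
        _ = Real.pi := by field_simp

theorem plane_nonneg (φ : Matrix B B ℝ) (m k : ℕ) : ∀ (j : ℕ) (a b : B), a ≠ b → M a b = m →
    NN (φ *ᵥ ev a) → NN (φ *ᵥ ev b) → j + k + 1 ≤ m →
    NN (φ *ᵥ (Rw M (altW M a b k)⁻¹ *ᵥ (Real.sin (j * (Real.pi / m)) • ev a +
      Real.sin ((j + 1 : ℕ) * (Real.pi / m)) • ev b))) := by
  induction k with
  | zero =>
    intro j a b hab hm ha hb hj
    simp only [altW_zero, inv_one, map_one, one_mulVec, mulVec_add, mulVec_smul]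
    exact NN_add (NN_smul (sin_nonneg_aux m j (by omega)) ha)
      (NN_smul (sin_nonneg_aux m (j + 1) (by omega)) hb)
  | succ k ih =>
    intro j a b hab hm ha hb hj
    have h1 := ih (j + 1) b a hab.symm (by rw [M.symmetric, hm]) hb ha (by omega)
    rw [altW_succ, _root_.mul_inv_rev, Rw_mul_mulVec, simple_inv', Rw_simple, mulVec_add,
      mulVec_smul, mulVec_smul, Tm_zero_ev, Tm_zero_ev, bil_zero_self, bil_ne M 0 hab, hm]
    convert h1 using 3
    have hs : Real.sin ((j + 1 + 1 : ℕ) * (Real.pi / m)) =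
        2 * Real.cos (Real.pi / m) * Real.sin ((j + 1 : ℕ) * (Real.pi / m))
          - Real.sin (j * (Real.pi / m)) := by
      have e1 : ((j + 1 + 1 : ℕ) : ℝ) * (Real.pi / m) =
        (j + 1 : ℕ) * (Real.pi / m) + (Real.pi / m) := by push_cast; ring
      have e2 : (j : ℝ) * (Real.pi / m) = (j + 1 : ℕ) * (Real.pi / m) - (Real.pi / m) := by
        push_cast; ring
      rw [e1, e2, Real.sin_add, Real.sin_sub]; ring
    rw [hs, Real.exp_zero]
    module

theorem sin_pos_aux (m : ℕ) (h : 2 ≤ m) : 0 < Real.sin (Real.pi / m) := by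
  apply Real.sin_pos_of_pos_of_lt_pi
  · have := Real.pi_pos; positivity
  · apply div_lt_self Real.pi_pos
    exact_mod_cast h

theorem plane_nonneg' [Finite M.Group] (φ : Matrix B B ℝ) (k : ℕ) (a b : B) (hab : a ≠ b)
    (ha : NN (φ *ᵥ ev a)) (hb : NN (φ *ᵥ ev b)) (hk : k + 1 ≤ M a b) :
    NN (φ *ᵥ (Rw M (altW M a b k)⁻¹ *ᵥ ev b)) := by
  have h := plane_nonneg M φ (M a b) k 0 a b hab rfl ha hb (by omega)
  have h2 := sin_pos_aux (M a b) (two_le_of_ne M hab (M_ne_zero M a b))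
  simp only [Nat.cast_zero, zero_mul, Real.sin_zero, zero_smul, zero_add, Nat.cast_one, one_mul,
    mulVec_smul] at h
  intro s
  have h3 := h s
  simp only [Pi.smul_apply, smul_eq_mul] at h3
  exact nonneg_of_mul_nonneg_right h3 h2

theorem tits_left [Finite M.Group] (n : ℕ) : ∀ (w : M.Group) (s : B),
    M.toCoxeterSystem.length w = n →
    ¬ M.toCoxeterSystem.IsLeftDescent w s → NN (Rw M w⁻¹ *ᵥ ev s) := by
  induction n using Nat.strong_induction_on with
  | _ n ih =>
    intro w s hn hs
    by_cases hw : w = 1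
    · rw [hw]; simpa using NN_ev s
    obtain ⟨t, ht⟩ := M.toCoxeterSystem.exists_leftDescent_of_ne_one hw
    have hts : t ≠ s := fun h => hs (h ▸ ht)
    obtain ⟨k, v, h1, h2, h3, h4⟩ := exists_decomp M n w t s hn hs
    have hk : k ≠ 0 := by
      rintro rfl
      rw [altW_zero, one_mul] at h1
      exact h3 (h1 ▸ ht)
    have hvt := ih _ (by omega) v t rfl h3
    have hvs := ih _ (by omega) v s rfl h4
    by_cases hkm : k + 1 ≤ M t s
    · rw [h1, _root_.mul_inv_rev, Rw_mul_mulVec]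
      exact plane_nonneg' M _ k t s hts hvt hvs hkm
    · exfalso
      apply hs
      obtain ⟨x, hx, hx'⟩ := altW_split M (M t s) t s k (by omega)
      have hm := two_le_of_ne M hts (M_ne_zero M t s)
      obtain ⟨m, hm'⟩ : ∃ m, M t s = m + 1 := ⟨M t s - 1, by omega⟩
      have e : M.simple s * w = altW M t s m * (x * v) := by
        rw [h1, hx, altW_braid, hm', altW_succ]
        simp only [← mul_assoc, simple_sq', one_mul]
      unfold CoxeterSystem.IsLeftDescent
      rw [CoxeterMatrix.toCoxeterSystem_simple, e]
      have l1 := M.toCoxeterSystem.length_mul_le (altW M t s m) (x * v)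
      have l2 := M.toCoxeterSystem.length_mul_le x v
      have l3 := length_altW_le M m t s
      omega

theorem root_nonneg [Finite M.Group] {w : M.Group} {s : B}
    (h : ¬ M.toCoxeterSystem.IsRightDescent w s) : NN (Rw M w *ᵥ ev s) := by
  have := tits_left M _ w⁻¹ s rfl (by rwa [M.toCoxeterSystem.isLeftDescent_inv_iff])
  rwa [inv_inv] at this

theorem root_nonpos [Finite M.Group] {w : M.Group} {s : B}
    (h : M.toCoxeterSystem.IsRightDescent w s) : NN (-(Rw M w *ᵥ ev s)) := by
  have h1 := M.toCoxeterSystem.isRightDescent_iff_not_isRightDescent_mul.mp h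
  have h2 := root_nonneg M h1
  rw [CoxeterMatrix.toCoxeterSystem_simple, Rw_mul_mulVec, Rw_simple, Tm_zero_ev,
    bil_zero_self] at h2
  have e : ev s - (2 : ℝ) • ev s = - ev s := by module
  rwa [e, mulVec_neg] at h2

theorem not_rightDescent_of_nonneg [Finite M.Group] {w : M.Group} {s : B}
    (h : NN (Rw M w *ᵥ ev s)) : ¬ M.toCoxeterSystem.IsRightDescent w s := fun h' =>
  Rw_mulVec_ne_zero M w (ev_ne_zero s) (eq_zero_of_NN h (root_nonpos M h'))

theorem rightDescent_of_nonpos [Finite M.Group] {w : M.Group} {s : B}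
    (h : NN (-(Rw M w *ᵥ ev s))) : M.toCoxeterSystem.IsRightDescent w s := by
  by_contra h'
  exact Rw_mulVec_ne_zero M w (ev_ne_zero s) (eq_zero_of_NN (root_nonneg M h') h)

theorem exists_decomp_two [Finite M.Group] (w : M.Group) (a b : B) (hab : a ≠ b)
    (ha : M.toCoxeterSystem.IsLeftDescent w a) (hb : M.toCoxeterSystem.IsLeftDescent w b) :
    ∃ v, w = altW M a b (M a b) * v ∧
      M.toCoxeterSystem.length w = M a b + M.toCoxeterSystem.length v := by
  have h1 := M.toCoxeterSystem.isLeftDescent_iff.mp ha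
  have h2 := M.toCoxeterSystem.isLeftDescent_iff_not_isLeftDescent_mul.mp ha
  simp only [CoxeterMatrix.toCoxeterSystem_simple] at h1 h2
  obtain ⟨k, v, h3, h4, h5, h6⟩ := exists_decomp M _ (M.simple a * w) b a rfl h2
  have hw : w = altW M a b (k + 1) * v := by
    rw [altW_succ, mul_assoc, ← h3, ← mul_assoc, simple_sq', one_mul]
  by_cases hk : k + 1 + 1 ≤ M a b
  · exfalso
    have h7 := plane_nonneg' M (Rw M v⁻¹) (k + 1) a b hab (tits_left M _ v a rfl h6)
      (tits_left M _ v b rfl h5) hk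
    rw [← Rw_mul_mulVec, ← _root_.mul_inv_rev, ← hw] at h7
    have h8 := not_rightDescent_of_nonneg M h7
    rw [M.toCoxeterSystem.isRightDescent_inv_iff] at h8
    exact h8 hb
  · obtain ⟨x, hx, hx'⟩ := altW_split M (M a b) a b (k + 1) (by omega)
    refine ⟨x * v, by rw [hw, hx, mul_assoc], ?_⟩
    have l1 := M.toCoxeterSystem.length_mul_le (altW M a b (M a b)) (x * v)
    have l2 := M.toCoxeterSystem.length_mul_le x v
    have l3 := length_altW_le M (M a b) a b
    rw [← mul_assoc, ← hx, ← hw] at l1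
    omega

/-- Alternating word. -/
def altL (a b : B) : ℕ → List B
  | 0 => []
  | n + 1 => a :: altL b a n

theorem altL_length (n : ℕ) : ∀ a b : B, (altL a b n).length = n := by
  induction n with
  | zero => intro a b; rfl
  | succ n ih => intro a b; simp [altL, ih]

theorem altL_map {G : Type*} [Monoid G] (f : B → G) (n : ℕ) : ∀ a b : B,
    ((altL a b n).map f).prod = altProd (f a) (f b) n := by
  induction n with
  | zero => intro a b; simp [altL, altProd]
  | succ n ih => intro a b; simp [altL, altProd, ih]

theorem sigma_braid {s t : B} (h0 : M s t ≠ 0) :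
    altProd (σ M s) (σ M t) (M s t) = altProd (σ M t) (σ M s) (M s t) := by
  have h : PresentedGroup.mk (artinRelationsSet M)
      (altProd (FreeGroup.of s) (FreeGroup.of t) (M s t) *
        (altProd (FreeGroup.of t) (FreeGroup.of s) (M s t))⁻¹) = 1 :=
    PresentedGroup.one_of_mem ⟨s, t, h0, rfl⟩
  rw [map_mul, map_inv, mul_inv_eq_one, altProd_map, altProd_map] at h
  exact h

theorem leftDescent_of_reduced_cons {a : B} {l : List B}
    (h : M.toCoxeterSystem.IsReduced (a :: l)) :
    M.toCoxeterSystem.IsLeftDescent (M.toCoxeterSystem.wordProd (a :: l)) a := by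
  unfold CoxeterSystem.IsLeftDescent
  have h1 := h.eq
  rw [h1, M.toCoxeterSystem.wordProd_cons, M.toCoxeterSystem.simple_mul_simple_cancel_left]
  have := M.toCoxeterSystem.length_wordProd_le l
  simp only [List.length_cons]
  omega

theorem reduced_tail {a : B} {l : List B}
    (h : M.toCoxeterSystem.IsReduced (a :: l)) : M.toCoxeterSystem.IsReduced l := by
  have := h.drop 1
  simpa using this

theorem matsumoto [Finite M.Group] (n : ℕ) : ∀ l l' : List B, l.length = n →
    M.toCoxeterSystem.IsReduced l → M.toCoxeterSystem.IsReduced l' →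
    M.toCoxeterSystem.wordProd l = M.toCoxeterSystem.wordProd l' →
    (l.map (σ M)).prod = (l'.map (σ M)).prod := by
  induction n with
  | zero =>
    intro l l' hl hr hr' h
    have h1 := hr.eq
    have h2 := hr'.eq
    rw [h, h2, hl] at h1
    rw [List.length_eq_zero_iff.mp hl, List.length_eq_zero_iff.mp h1]
  | succ n ih =>
    have same : ∀ (a : B) (l l' : List B), l.length = n →
        M.toCoxeterSystem.IsReduced (a :: l) → M.toCoxeterSystem.IsReduced (a :: l') →
        M.toCoxeterSystem.wordProd (a :: l) = M.toCoxeterSystem.wordProd (a :: l') →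
        ((a :: l).map (σ M)).prod = ((a :: l').map (σ M)).prod := by
      intro a l l' hl hr hr' h
      rw [M.toCoxeterSystem.wordProd_cons, M.toCoxeterSystem.wordProd_cons] at h
      have h1 := ih l l' hl (reduced_tail M hr) (reduced_tail M hr') (mul_left_cancel h)
      simp only [List.map_cons, List.prod_cons, h1]
    intro l l' hl hr hr' h
    have hlen : l.length = l'.length := by rw [← hr.eq, h, hr'.eq]
    obtain ⟨a, l, rfl⟩ := List.exists_cons_of_length_eq_add_one hl
    obtain ⟨b, l', rfl⟩ := List.exists_cons_of_length_eq_add_one (hlen ▸ hl)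
    simp only [List.length_cons] at hl hlen
    by_cases hab : a = b
    · subst hab
      exact same a l l' (by omega) hr hr' h
    have da := leftDescent_of_reduced_cons M hr
    have db := leftDescent_of_reduced_cons M hr'
    rw [← h] at db
    obtain ⟨v, hv, hv'⟩ := exists_decomp_two M _ a b hab da db
    obtain ⟨l3, hl3, rfl⟩ := M.toCoxeterSystem.exists_isReduced v
    have hm := two_le_of_ne M hab (M_ne_zero M a b)
    obtain ⟨m, hm'⟩ : ∃ m, M a b = m + 1 := ⟨M a b - 1, by omega⟩
    have hwp : ∀ c d : B, M.toCoxeterSystem.wordProd (altL c d (m + 1) ++ l3) =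
        altW M c d (m + 1) * M.toCoxeterSystem.wordProd l3 := by
      intro c d
      rw [M.toCoxeterSystem.wordProd_append, CoxeterSystem.wordProd, altL_map]
      rfl
    have hbr := altW_braid M a b
    rw [hm'] at hv hv' hbr
    have p1 := hwp a b
    have p2 := hwp b a
    rw [← hv] at p1
    rw [← hbr, ← hv] at p2
    rw [hr.eq, hl3.eq] at hv'
    simp only [List.length_cons] at hv'
    have r1 : M.toCoxeterSystem.IsReduced (altL a b (m + 1) ++ l3) := by
      unfold CoxeterSystem.IsReduced
      rw [p1, hr.eq, List.length_append, altL_length, List.length_cons]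
      omega
    have r2 : M.toCoxeterSystem.IsReduced (altL b a (m + 1) ++ l3) := by
      unfold CoxeterSystem.IsReduced
      rw [p2, hr.eq, List.length_append, altL_length, List.length_cons]
      omega
    have q1 := same a l (altL b a m ++ l3) (by omega) hr r1 p1.symm
    have q2 := same b l' (altL a b m ++ l3) (by omega) hr' r2 (by rw [← h]; exact p2.symm)
    rw [q1, q2]
    have z : ∀ c d : B, ((c :: (altL d c m ++ l3)).map (σ M)).prod =
        altProd (σ M c) (σ M d) (m + 1) * (l3.map (σ M)).prod := by
      intro c d
      rw [← altL_map (σ M), ← List.prod_append, ← List.map_append]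
      rfl
    have hs := sigma_braid M (M_ne_zero M a b)
    rw [hm'] at hs
    rw [z, z, hs]

end Tits

section Longest
variable [Fintype B] [DecidableEq B] (M : CoxeterMatrix B) [Finite M.Group]

theorem len_mul_nonneg {w : M.Group} {s : B} (h : NN (Rw M w *ᵥ ev s)) :
    M.toCoxeterSystem.length (w * M.simple s) = M.toCoxeterSystem.length w + 1 :=
  M.toCoxeterSystem.not_isRightDescent_iff.mp (not_rightDescent_of_nonneg M h)

theorem len_mul_nonpos {w : M.Group} {s : B} (h : NN (-(Rw M w *ᵥ ev s))) :
    M.toCoxeterSystem.length (w * M.simple s) + 1 = M.toCoxeterSystem.length w :=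
  M.toCoxeterSystem.isRightDescent_iff.mp (rightDescent_of_nonpos M h)

theorem root_or (w : M.Group) (s : B) :
    NN (Rw M w *ᵥ ev s) ∨ NN (-(Rw M w *ᵥ ev s)) := by
  by_cases h : M.toCoxeterSystem.IsRightDescent w s
  · exact Or.inr (root_nonpos M h)
  · exact Or.inl (root_nonneg M h)

theorem InSpan_add {X : Set B} {u v : B → ℝ} (hu : InSpan X u) (hv : InSpan X v) :
    InSpan X (u + v) := fun s hs => by simp [hu s hs, hv s hs]

theorem InSpan_smul {X : Set B} (r : ℝ) {u : B → ℝ} (hu : InSpan X u) :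
    InSpan X (r • u) := fun s hs => by simp [hu s hs]

theorem InSpan_neg {X : Set B} {u : B → ℝ} (hu : InSpan X u) :
    InSpan X (-u) := fun s hs => by simp [hu s hs]

theorem InSpan_ev {X : Set B} {s : B} (hs : s ∈ X) : InSpan X (ev s) :=
  fun _ ht => ev_ne (fun e => ht (e ▸ hs))

theorem mem_of_InSpan_ev {X : Set B} {s : B} (h : InSpan X (ev s)) : s ∈ X := by
  by_contra hs
  have := h s hs
  rw [ev_self] at this
  exact one_ne_zero this

theorem ev_inj {s t : B} (h : ev s = ev t) : s = t := by
  by_contra hne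
  have := congrFun h s
  rw [ev_self, ev_ne hne] at this
  exact one_ne_zero this

theorem mulVec_span {X Y : Set B} (A : Matrix B B ℝ) (h : ∀ z ∈ X, InSpan Y (A *ᵥ ev z))
    {u : B → ℝ} (hu : InSpan X u) : InSpan Y (A *ᵥ u) := by
  intro s hs
  refine Finset.sum_eq_zero fun t _ => ?_
  by_cases ht : t ∈ X
  · have := h t ht s hs
    rw [mulVec_ev] at this
    exact mul_eq_zero_of_left this _
  · rw [hu t ht, mul_zero]

theorem mulVec_nonpos {X : Set B} (A : Matrix B B ℝ) (h : ∀ z ∈ X, NN (-(A *ᵥ ev z)))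
    {u : B → ℝ} (hu : InSpan X u) (hn : NN u) : NN (-(A *ᵥ u)) := by
  intro s
  rw [Pi.neg_apply, neg_nonneg]
  refine Finset.sum_nonpos fun t _ => ?_
  by_cases ht : t ∈ X
  · have := h t ht s
    rw [Pi.neg_apply, mulVec_ev, neg_nonneg] at this
    exact mul_nonpos_of_nonpos_of_nonneg this (hn t)
  · rw [hu t ht, mul_zero]

theorem WP_span {X : Set B} {v : M.Group} (hv : v ∈ WP M X) :
    ∀ u : B → ℝ, InSpan X (Rw M v *ᵥ u - u) := by
  unfold WP at hv
  induction hv using Subgroup.closure_induction with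
  | mem x hx =>
    obtain ⟨s, hs, rfl⟩ := hx
    intro u
    rw [Rw_simple, Tm_mulVec']
    have e : u - (bil M 0 *ᵥ u) s • ev s - u = (-(bil M 0 *ᵥ u) s) • ev s := by module
    rw [e]
    exact InSpan_smul _ (InSpan_ev hs)
  | one => intro u s _; simp
  | mul x y _ _ hx hy =>
    intro u
    rw [Rw_mul_mulVec]
    have := InSpan_add (hx (Rw M y *ᵥ u)) (hy u)
    rwa [sub_add_sub_cancel] at this
  | inv x _ hx =>
    intro u
    have := InSpan_neg (hx (Rw M x⁻¹ *ᵥ u))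
    rwa [Rw_mulVec_inv, neg_sub] at this

theorem WP_span' {X : Set B} {v : M.Group} (hv : v ∈ WP M X) {u : B → ℝ} (hu : InSpan X u) :
    InSpan X (Rw M v *ᵥ u) := by
  have := InSpan_add (WP_span M hv u) hu
  rwa [sub_add_cancel] at this

theorem simple_mem_WP {X : Set B} {s : B} (hs : s ∈ X) : M.simple s ∈ WP M X :=
  Subgroup.subset_closure ⟨s, hs, rfl⟩

theorem mem_of_simple_mem {X : Set B} {s : B} (hs : M.simple s ∈ WP M X) : s ∈ X := by
  have h := WP_span M hs (ev s)
  rw [Rw_simple, Tm_zero_ev, bil_zero_self] at h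
  apply mem_of_InSpan_ev
  have := InSpan_smul (-(1/2) : ℝ) h
  convert this using 1
  module

theorem len_mul_par {X : Set B} {w : M.Group} (hw : ∀ x ∈ X, NN (-(Rw M w *ᵥ ev x)))
    {v : M.Group} (hv : v ∈ WP M X) :
    M.toCoxeterSystem.length (w * v) + M.toCoxeterSystem.length v =
      M.toCoxeterSystem.length w := by
  unfold WP at hv
  have key : ∀ v ∈ WP M X, ∀ s ∈ X, M.toCoxeterSystem.length (w * v) +
      M.toCoxeterSystem.length v = M.toCoxeterSystem.length w →
      M.toCoxeterSystem.length (w * (v * M.simple s)) +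
      M.toCoxeterSystem.length (v * M.simple s) = M.toCoxeterSystem.length w := by
    intro v hv s hs ih
    have hsp := WP_span' M hv (InSpan_ev hs)
    rw [← mul_assoc]
    rcases root_or M v s with h | h
    · have h1 := len_mul_nonneg M h
      have h2 := mulVec_nonpos _ hw hsp h
      rw [← Rw_mul_mulVec] at h2
      have h3 := len_mul_nonpos M h2
      omega
    · have h1 := len_mul_nonpos M h
      have h2 := mulVec_nonpos _ hw (InSpan_neg hsp) h
      rw [mulVec_neg, neg_neg, ← Rw_mul_mulVec] at h2
      have h3 := len_mul_nonneg M h2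
      omega
  induction hv using Subgroup.closure_induction_right with
  | one => simp
  | mul_right x hx y hy ih =>
    obtain ⟨s, hs, rfl⟩ := hy
    exact key x hx s hs ih
  | mul_inv_cancel x hx y hy ih =>
    obtain ⟨s, hs, rfl⟩ := hy
    rw [simple_inv']
    exact key x hx s hs ih

theorem exists_longest (X : Set B) : ∃ w, IsLongestIn M X w := by
  obtain ⟨w, hw⟩ := Finite.exists_max (fun v : WP M X => M.toCoxeterSystem.length v.1)
  exact ⟨w.1, w.2, fun v hv => hw ⟨v, hv⟩⟩

variable {M}

theorem IsLongestIn.nonpos {X : Set B} {w : M.Group} (hw : IsLongestIn M X w) :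
    ∀ x ∈ X, NN (-(Rw M w *ᵥ ev x)) := by
  intro x hx
  rcases root_or M w x with h | h
  · have h1 := len_mul_nonneg M h
    have h2 := hw.2 _ (mul_mem hw.1 (simple_mem_WP M hx))
    omega
  · exact h

theorem IsLongestIn.mul_eq_one {X : Set B} {w w' : M.Group} (hw : IsLongestIn M X w)
    (hw' : IsLongestIn M X w') : w * w' = 1 := by
  have h1 := len_mul_par M hw.nonpos hw'.1
  have h2 := hw.2 _ hw'.1
  have h3 := hw'.2 _ hw.1
  exact M.toCoxeterSystem.length_eq_zero_iff.mp (by omega)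

theorem IsLongestIn.unique {X : Set B} {w w' : M.Group} (hw : IsLongestIn M X w)
    (hw' : IsLongestIn M X w') : w = w' :=
  (eq_inv_of_mul_eq_one_left (hw.mul_eq_one hw')).trans
    (eq_inv_of_mul_eq_one_left (hw'.mul_eq_one hw')).symm

theorem norm_aux {w : M.Group} {s s' : B} {c : ℝ} (h : Rw M w *ᵥ ev s = c • ev s') :
    c * c = 1 := by
  have h1 := Rw_invariant M w (ev s) (ev s)
  rw [h, mulVec_smul, smul_dotProduct, dotProduct_smul, ev_dotProduct, ev_dotProduct, mulVec_ev,
    mulVec_ev, bil_zero_self, bil_zero_self, smul_eq_mul, smul_eq_mul] at h1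
  linarith

theorem IsLongestIn.perm {X : Set B} {w : M.Group} (hw : IsLongestIn M X w) {s : B}
    (hs : s ∈ X) : ∃ s' ∈ X, M.simple s' * w = w * M.simple s ∧
      M.simple s * w = w * M.simple s' ∧ Rw M w *ᵥ ev s = - ev s' := by
  have hww := hw.mul_eq_one hw
  have hinv : w⁻¹ = w := inv_eq_of_mul_eq_one_left hww
  have hm := simple_mem_WP M hs
  have h1 := len_mul_nonpos M (hw.nonpos s hs)
  have h2 := len_mul_par M hw.nonpos (mul_mem hm hw.1)
  have h3 : M.toCoxeterSystem.length (M.simple s * w) =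
      M.toCoxeterSystem.length (w * M.simple s) := by
    rw [← M.toCoxeterSystem.length_inv, _root_.mul_inv_rev, hinv, simple_inv']
  obtain ⟨s', hs'⟩ := M.toCoxeterSystem.length_eq_one_iff.mp
    (show M.toCoxeterSystem.length (w * (M.simple s * w)) = 1 by omega)
  rw [CoxeterMatrix.toCoxeterSystem_simple] at hs'
  have e1 : M.simple s' * w = w * M.simple s := by
    rw [← hs', mul_assoc, mul_assoc, hww, mul_one]
  have e2 : M.simple s * w = w * M.simple s' := by
    rw [← hs', ← mul_assoc, hww, one_mul]
  refine ⟨s', mem_of_simple_mem M (hs' ▸ mul_mem hw.1 (mul_mem hm hw.1)), e1, e2, ?_⟩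
  have h4 : Rw M (M.simple s' * w) *ᵥ ev s = Rw M (w * M.simple s) *ᵥ ev s := by rw [e1]
  rw [Rw_mul_mulVec, Rw_mul_mulVec, Rw_simple, Rw_simple, Tm_zero_ev, bil_zero_self,
    Tm_mulVec'] at h4
  have e : ev s - (2 : ℝ) • ev s = - ev s := by module
  rw [e, mulVec_neg] at h4
  set α := Rw M w *ᵥ ev s with hα
  set k := (bil M 0 *ᵥ α) s'
  have h5 : α = (k / 2) • ev s' := by
    funext b
    have := congrFun h4 b
    simp only [Pi.sub_apply, Pi.smul_apply, Pi.neg_apply, smul_eq_mul] at this ⊢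
    linarith
  have h6 := norm_aux (hα.symm.trans h5)
  have h7 := hw.nonpos s hs s'
  rw [← hα, h5, Pi.neg_apply, Pi.smul_apply, ev_self, smul_eq_mul, mul_one] at h7
  have h8 : k / 2 = -1 := by nlinarith
  rw [h5, h8, neg_one_smul]

theorem delta_conj {X : Set B} {w : M.Group} (hw : IsLongestIn M X w) {d : ArtinGroup M}
    (hd : IsDeltaOf M X d) {s s' : B} (hs : s ∈ X) (h : M.simple s' * w = w * M.simple s) :
    σ M s' * d = d * σ M s := by
  obtain ⟨l, -, hlr, hl, rfl⟩ := hd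
  have hlw := hl.unique hw
  obtain ⟨lu, hlu, hu⟩ := M.toCoxeterSystem.exists_isReduced (w * M.simple s)
  have h1 := len_mul_nonpos M (hw.nonpos s hs)
  have p1 : M.toCoxeterSystem.wordProd (lu ++ [s]) = w := by
    rw [M.toCoxeterSystem.wordProd_append, ← hu, M.toCoxeterSystem.wordProd_singleton,
      CoxeterMatrix.toCoxeterSystem_simple, mul_assoc, simple_sq', mul_one]
  have p2 : M.toCoxeterSystem.wordProd (s' :: lu) = w := by
    rw [M.toCoxeterSystem.wordProd_cons, ← hu, CoxeterMatrix.toCoxeterSystem_simple, ← h,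
      ← mul_assoc, simple_sq', one_mul]
  have hlen : lu.length = M.toCoxeterSystem.length (w * M.simple s) := by
    rw [hu]; exact hlu.symm
  have r1 : M.toCoxeterSystem.IsReduced (lu ++ [s]) := by
    unfold CoxeterSystem.IsReduced
    rw [p1, List.length_append, List.length_singleton]; omega
  have r2 : M.toCoxeterSystem.IsReduced (s' :: lu) := by
    unfold CoxeterSystem.IsReduced
    rw [p2, List.length_cons]; omega
  have m1 := matsumoto M _ l _ rfl hlr r1 (hlw.trans p1.symm)
  have m2 := matsumoto M _ l _ rfl hlr r2 (hlw.trans p2.symm)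
  simp only [List.map_append, List.map_cons, List.map_nil, List.prod_append, List.prod_cons,
    List.prod_nil, mul_one] at m1 m2
  calc σ M s' * (l.map (σ M)).prod = σ M s' * ((lu.map (σ M)).prod * σ M s) := by rw [m1]
    _ = (l.map (σ M)).prod * σ M s := by rw [m2, mul_assoc]

variable (M)

/-- One conjugation by an adjacent ribbon. -/
def Step (Y Y' : Set B) (t : B) : Prop :=
  (t ∉ Y ∧ ∃ x ∈ Y, Adj M t x) ∧ ∀ d₁ d₂ : ArtinGroup M, IsDeltaOf M Y d₁ →
    IsDeltaOf M (insert t Y) d₂ →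
    (fun x => (d₁⁻¹ * d₂)⁻¹ * x * (d₁⁻¹ * d₂)) '' (σ M '' Y) = σ M '' Y'

variable {M}

theorem ribbon_conj {Y : Set B} {t : B} {wY wX : M.Group} (hY : IsLongestIn M Y wY)
    (hX : IsLongestIn M (insert t Y) wX) {y : B} (hy : y ∈ Y) :
    ∃ y2, Rw M (wX * wY) *ᵥ ev y = ev y2 ∧ ∀ d₁ d₂ : ArtinGroup M, IsDeltaOf M Y d₁ →
      IsDeltaOf M (insert t Y) d₂ →
      (d₁⁻¹ * d₂)⁻¹ * σ M y * (d₁⁻¹ * d₂) = σ M y2 := by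
  obtain ⟨y1, hy1, a1, b1, c1⟩ := hY.perm hy
  obtain ⟨y2, hy2, a2, b2, c2⟩ := hX.perm (Set.mem_insert_of_mem t hy1)
  refine ⟨y2, ?_, ?_⟩
  · rw [Rw_mul_mulVec, c1, mulVec_neg, c2, neg_neg]
  · intro d₁ d₂ h1 h2
    have e1 := delta_conj hY h1 hy a1
    have e2 := delta_conj hX h2 hy2 b2
    calc (d₁⁻¹ * d₂)⁻¹ * σ M y * (d₁⁻¹ * d₂) = d₂⁻¹ * (d₁ * σ M y) * d₁⁻¹ * d₂ := by group
      _ = d₂⁻¹ * (σ M y1 * d₂) := by rw [← e1]; group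
      _ = σ M y2 := by rw [e2]; group

theorem step_of {Y : Set B} {t : B} {wY wX : M.Group} (hY : IsLongestIn M Y wY)
    (hX : IsLongestIn M (insert t Y) wX) (ht : t ∉ Y) (hadj : ∃ x ∈ Y, Adj M t x) :
    Step M Y {s | ∃ y ∈ Y, Rw M (wX * wY) *ᵥ ev y = ev s} t := by
  refine ⟨⟨ht, hadj⟩, fun d₁ d₂ h1 h2 => ?_⟩
  ext x
  constructor
  · rintro ⟨_, ⟨y, hy, rfl⟩, rfl⟩
    obtain ⟨y2, e, hc⟩ := ribbon_conj hY hX hy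
    exact ⟨y2, ⟨y, hy, e⟩, (hc d₁ d₂ h1 h2).symm⟩
  · rintro ⟨s, ⟨y, hy, e⟩, rfl⟩
    obtain ⟨y2, e', hc⟩ := ribbon_conj hY hX hy
    obtain rfl := ev_inj (e.symm.trans e')
    exact ⟨_, ⟨y, hy, rfl⟩, hc d₁ d₂ h1 h2⟩

theorem monomial_aux {Y : Set B} {w : M.Group} {z : B} (h1 : NN (Rw M w *ᵥ ev z))
    (h2 : InSpan Y (Rw M w *ᵥ ev z)) (h3 : ∀ y ∈ Y, NN (Rw M w⁻¹ *ᵥ ev y)) :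
    ∃ y ∈ Y, Rw M w *ᵥ ev z = ev y := by
  obtain ⟨y, hy⟩ : ∃ y, (Rw M w *ᵥ ev z) y ≠ 0 := by
    by_contra hcon
    push Not at hcon
    exact Rw_mulVec_ne_zero M w (ev_ne_zero z) (funext hcon)
  have hyY : y ∈ Y := by
    by_contra h
    exact hy (h2 y h)
  have h4 : ∀ s, s ≠ z → (Rw M w⁻¹ *ᵥ ev y) s = 0 := by
    intro s hs
    have e := congrFun (Rw_inv_mulVec M w (ev z)) s
    rw [ev_ne hs] at e
    have hnn : ∀ t ∈ Finset.univ, 0 ≤ Rw M w⁻¹ s t * (Rw M w *ᵥ ev z) t := by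
      intro t _
      by_cases ht : t ∈ Y
      · have := h3 t ht s
        rw [mulVec_ev] at this
        exact mul_nonneg this (h1 t)
      · rw [h2 t ht, mul_zero]
    have := (Finset.sum_eq_zero_iff_of_nonneg hnn).mp e y (Finset.mem_univ y)
    rw [mulVec_ev]
    exact (mul_eq_zero.mp this).resolve_right hy
  have h5 : Rw M w⁻¹ *ᵥ ev y = ((Rw M w⁻¹ *ᵥ ev y) z) • ev z := by
    funext s
    by_cases hs : s = z
    · subst hs; simp [ev_self]
    · rw [h4 s hs, Pi.smul_apply, ev_ne hs, smul_zero]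
  have h6 := norm_aux h5
  have h7 := h3 y hyY z
  have h8 : (Rw M w⁻¹ *ᵥ ev y) z = 1 := by nlinarith
  rw [h8, one_smul] at h5
  exact ⟨y, hyY, by rw [← h5, Rw_mulVec_inv]⟩

theorem exists_perm (n : ℕ) : ∀ (w : M.Group) (Y Z : Set B),
    M.toCoxeterSystem.length w = n →
    (∀ u, InSpan Y u → InSpan Z (Rw M w⁻¹ *ᵥ u)) →
    (∀ u, InSpan Z u → InSpan Y (Rw M w *ᵥ u)) →
    ∃ w' : M.Group, (∀ z ∈ Z, ∃ y ∈ Y, Rw M w' *ᵥ ev z = ev y) ∧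
      (∀ y ∈ Y, ∃ z ∈ Z, Rw M w' *ᵥ ev z = ev y) := by
  induction n using Nat.strong_induction_on with
  | _ n ih =>
  intro w Y Z hn hY hZ
  by_cases hz : ∃ z ∈ Z, NN (-(Rw M w *ᵥ ev z))
  · obtain ⟨z, hz, hneg⟩ := hz
    have := len_mul_nonpos M hneg
    have hm := simple_mem_WP M hz
    refine ih _ (by omega) (w * M.simple z) Y Z rfl ?_ ?_
    · intro u hu
      rw [_root_.mul_inv_rev, Rw_mul_mulVec]
      exact WP_span' M (inv_mem hm) (hY u hu)
    · intro u hu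
      rw [Rw_mul_mulVec]
      exact hZ _ (WP_span' M hm hu)
  by_cases hy : ∃ y ∈ Y, NN (-(Rw M w⁻¹ *ᵥ ev y))
  · obtain ⟨y, hy, hneg⟩ := hy
    have h1 := len_mul_nonpos M hneg
    have hm := simple_mem_WP M hy
    have h2 : w⁻¹ * M.simple y = (M.simple y * w)⁻¹ := by
      rw [_root_.mul_inv_rev, simple_inv']
    rw [M.toCoxeterSystem.length_inv, h2, M.toCoxeterSystem.length_inv] at h1
    refine ih _ (by omega) (M.simple y * w) Y Z rfl ?_ ?_
    · intro u hu
      rw [_root_.mul_inv_rev, Rw_mul_mulVec]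
      exact hY _ (WP_span' M (inv_mem hm) hu)
    · intro u hu
      rw [Rw_mul_mulVec]
      exact WP_span' M hm (hZ u hu)
  have hz' : ∀ z ∈ Z, NN (Rw M w *ᵥ ev z) := fun z h =>
    (root_or M w z).resolve_right (fun h' => hz ⟨z, h, h'⟩)
  have hy' : ∀ y ∈ Y, NN (Rw M w⁻¹ *ᵥ ev y) := fun y h =>
    (root_or M w⁻¹ y).resolve_right (fun h' => hy ⟨y, h, h'⟩)
  refine ⟨w, fun z h => monomial_aux (hz' z h) (hZ _ (InSpan_ev h)) hy', fun y h => ?_⟩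
  obtain ⟨z, hzZ, e⟩ := monomial_aux (hy' y h) (hY _ (InSpan_ev h)) (by rwa [inv_inv])
  exact ⟨z, hzZ, by rw [← e, Rw_mulVec_inv]⟩

theorem chain_of_perm (Z : Set B) (n : ℕ) : ∀ (w : M.Group) (Y : Set B),
    M.toCoxeterSystem.length w = n →
    (∀ z ∈ Z, ∃ y ∈ Y, Rw M w *ᵥ ev z = ev y) →
    (∀ y ∈ Y, ∃ z ∈ Z, Rw M w *ᵥ ev z = ev y) →
    Relation.ReflTransGen (fun Y Y' => ∃ t, Step M Y Y' t) Y Z := by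
  induction n using Nat.strong_induction_on with
  | _ n ih =>
  intro w Y hn hZ hY
  by_cases hw1 : w = 1
  · have : Y = Z := by
      subst hw1
      simp only [map_one, one_mulVec] at hY hZ
      ext s
      constructor
      · intro hs
        obtain ⟨z, hz, e⟩ := hY s hs
        exact ev_inj e ▸ hz
      · intro hs
        obtain ⟨y, hy, e⟩ := hZ s hs
        exact ev_inj e ▸ hy
    rw [this]
  have hYinv : ∀ y ∈ Y, ∃ z ∈ Z, Rw M w⁻¹ *ᵥ ev y = ev z := by
    intro y hy
    obtain ⟨z, hz, e⟩ := hY y hy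
    exact ⟨z, hz, by rw [← e, Rw_inv_mulVec]⟩
  obtain ⟨t, htd⟩ := M.toCoxeterSystem.exists_leftDescent_of_ne_one hw1
  have htn : NN (-(Rw M w⁻¹ *ᵥ ev t)) :=
    root_nonpos M (M.toCoxeterSystem.isRightDescent_inv_iff.mpr htd)
  have htY : t ∉ Y := by
    intro h
    obtain ⟨z, _, e⟩ := hYinv t h
    rw [e] at htn
    exact ev_ne_zero z (eq_zero_of_NN (NN_ev z) htn)
  by_cases hadj : ∃ x ∈ Y, Adj M t x
  · obtain ⟨wY, hwY⟩ := exists_longest M Y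
    obtain ⟨wX, hwX⟩ := exists_longest M (insert t Y)
    have iY : wY⁻¹ = wY := inv_eq_of_mul_eq_one_left (hwY.mul_eq_one hwY)
    have iX : wX⁻¹ = wX := inv_eq_of_mul_eq_one_left (hwX.mul_eq_one hwX)
    have hq := WP_span M hwY.1 (ev t)
    have hqt : (Rw M wY *ᵥ ev t) t = 1 := by
      have := hq t htY
      rw [Pi.sub_apply, ev_self] at this
      linarith
    -- length comparison of the two longest elements
    have hlt : M.toCoxeterSystem.length wY < M.toCoxeterSystem.length wX := by
      have hsub : WP M Y ≤ WP M (insert t Y) :=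
        Subgroup.closure_mono (Set.image_mono (Set.subset_insert t Y))
      have h1 := hwX.2 _ (mul_mem (hsub hwY.1) (simple_mem_WP M (Set.mem_insert t Y)))
      have h2 : NN (Rw M wY *ᵥ ev t) := by
        refine (root_or M wY t).resolve_right fun h => ?_
        have := h t
        rw [Pi.neg_apply, hqt] at this
        linarith
      have h3 := len_mul_nonneg M h2
      omega
    have hneg : ∀ x ∈ insert t Y, NN (-(Rw M (w⁻¹ * wY) *ᵥ ev x)) := by
      intro x hx
      rcases Set.mem_insert_iff.mp hx with rfl | hx
      · refine (root_or M (w⁻¹ * wY) x).resolve_left fun h => ?_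
        have hsp : InSpan Z (Rw M w⁻¹ *ᵥ (Rw M wY *ᵥ ev x - ev x)) := by
          refine mulVec_span (X := Y) _ (fun y hy => ?_) hq
          obtain ⟨z, hz, e⟩ := hYinv y hy
          rw [e]
          exact InSpan_ev hz
        have hsp2 : InSpan Z (Rw M w⁻¹ *ᵥ ev x) := by
          intro s hs
          have h1 := hsp s hs
          rw [mulVec_sub, ← Rw_mul_mulVec, Pi.sub_apply] at h1
          have h2 := h s
          have h3 := htn s
          rw [Pi.neg_apply] at h3
          linarith
        have hsp3 : InSpan Y (Rw M w *ᵥ (Rw M w⁻¹ *ᵥ ev x)) := by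
          refine mulVec_span _ (fun z hz => ?_) hsp2
          obtain ⟨y, hy, e⟩ := hZ z hz
          rw [e]
          exact InSpan_ev hy
        rw [Rw_mulVec_inv] at hsp3
        exact htY (mem_of_InSpan_ev hsp3)
      · obtain ⟨y1, hy1, -, -, c1⟩ := hwY.perm hx
        obtain ⟨z, hz, e⟩ := hYinv y1 hy1
        rw [Rw_mul_mulVec, c1, mulVec_neg, neg_neg, e]
        exact NN_ev z
    have hlen := len_mul_par M hneg hwX.1
    have hle := M.toCoxeterSystem.length_mul_le w⁻¹ wY
    rw [M.toCoxeterSystem.length_inv] at hle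
    have hu : w⁻¹ * wY * wX = (wX * wY * w)⁻¹ := by
      rw [_root_.mul_inv_rev, _root_.mul_inv_rev, iX, iY, mul_assoc]
    rw [hu, M.toCoxeterSystem.length_inv] at hlen
    refine Relation.ReflTransGen.head ⟨t, step_of hwY hwX htY hadj⟩
      (ih _ (by omega) (wX * wY * w) _ rfl ?_ ?_)
    · intro z hz
      obtain ⟨y, hy, e⟩ := hZ z hz
      obtain ⟨y2, e2, -⟩ := ribbon_conj hwY hwX hy
      exact ⟨y2, ⟨y, hy, e2⟩, by rw [Rw_mul_mulVec, e, e2]⟩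
    · rintro s ⟨y, hy, e⟩
      obtain ⟨z, hz, e'⟩ := hY y hy
      exact ⟨z, hz, by rw [Rw_mul_mulVec, e', e]⟩
  · have hfix : ∀ y ∈ Y, Rw M (M.simple t) *ᵥ ev y = ev y := by
      intro y hy
      have hne : t ≠ y := fun e => htY (e ▸ hy)
      have h2 : M t y = 2 := by
        by_contra h
        exact hadj ⟨y, hy, hne, h⟩
      rw [Rw_simple, Tm_zero_ev, bil_ne M 0 hne, h2]
      simp
    refine ih _ ?_ (M.simple t * w) Y rfl ?_ ?_
    · rw [← hn]; exact htd
    · intro z hz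
      obtain ⟨y, hy, e⟩ := hZ z hz
      exact ⟨y, hy, by rw [Rw_mul_mulVec, e, hfix y hy]⟩
    · intro y hy
      obtain ⟨z, hz, e⟩ := hY y hy
      exact ⟨z, hz, by rw [Rw_mul_mulVec, e, hfix y hy]⟩

theorem chain_fin (Y Z : Set B)
    (h : Relation.ReflTransGen (fun Y Y' => ∃ t, Step M Y Y' t) Y Z) :
    ∃ n : ℕ, ∃ Ys : Fin (n + 1) → Set B, Ys 0 = Y ∧ Ys (Fin.last n) = Z ∧
      ∃ ts : Fin n → B, ∀ i : Fin n, Step M (Ys i.castSucc) (Ys i.succ) (ts i) := by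
  induction h using Relation.ReflTransGen.head_induction_on with
  | refl => exact ⟨0, fun _ => Z, rfl, rfl, Fin.elim0, fun i => i.elim0⟩
  | head hst _ ih =>
    rename_i Y₀ Y₁ _
    obtain ⟨t, ht⟩ := hst
    obtain ⟨n, Ys, h0, hl, ts, hs⟩ := ih
    refine ⟨n + 1, Fin.cons Y₀ Ys, by simp, ?_, Fin.cons t ts, ?_⟩
    · rw [← Fin.succ_last, Fin.cons_succ, hl]
    · intro i
      refine Fin.cases ?_ (fun j => ?_) i
      · simpa [h0] using ht
      · simpa [← Fin.succ_castSucc] using hs j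

end Longest
end Helpers
/-- Lemma 5 of the paper: two conjugate positive elements with proper support are connected by
a sequence of conjugations by adjacent ribbons `r(t_i, Y_{i-1}) = Δ_{Y_{i-1}}⁻¹ Δ_{Y_{i-1} ∪ {t_i}}`
sending `Σ_{Y_{i-1}}` onto `Σ_{Y_i}`. -/
theorem conjugate_positive_via_adjacent_ribbons
    [Finite B] (M : CoxeterMatrix B) [Finite M.Group]
    (g h : ArtinGroup M) (hg : IsPositive M g) (hh : IsPositive M h)
    (Y Z : Set B) (hY : Supp M g = Y) (hZ : Supp M h = Z)
    (hYproper : Y ≠ Set.univ) (hZproper : Z ≠ Set.univ)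
    (hconj : ∃ c : ArtinGroup M, c⁻¹ * g * c = h) :
    ∃ n : ℕ, ∃ Ys : Fin (n + 1) → Set B, Ys 0 = Y ∧ Ys (Fin.last n) = Z ∧
      ∃ ts : Fin n → B,
        ∀ i : Fin n,
          (ts i ∉ Ys i.castSucc ∧ ∃ x ∈ Ys i.castSucc, Adj M (ts i) x) ∧
          ∀ d₁ d₂ : ArtinGroup M,
            IsDeltaOf M (Ys i.castSucc) d₁ →
            IsDeltaOf M (insert (ts i) (Ys i.castSucc)) d₂ →
            (fun x => (d₁⁻¹ * d₂)⁻¹ * x * (d₁⁻¹ * d₂)) '' (σ M '' Ys i.castSucc) =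
              σ M '' Ys i.succ := by
  classical
  cases nonempty_fintype B
  obtain ⟨l, rfl⟩ := hg
  obtain ⟨l', rfl⟩ := hh
  obtain ⟨c, hc⟩ := hconj
  rw [supp_word] at hY hZ
  obtain ⟨w, hw1, hw2⟩ := exists_span_map M l l' c hc
  rw [hY, hZ] at hw1 hw2
  obtain ⟨w', h1, h2⟩ := exists_perm _ w Y Z rfl hw1 hw2
  exact chain_fin Y Z (chain_of_perm Z _ w' Y rfl h1 h2)

end ArtinTits
end

section
/- Let k ≥ 2 and let A_S be the Artin-Tits group of type D_{2k+1} with generators σ_1,…,σ_{2k+1}, and let X = {s_1,…,s_{2k}} (a standard parabolic subset of type D_{2k}). Then the elements g = σ_1σ_3σ_4⋯σ_{2k} and h = σ_2σ_3σ_4⋯σ_{2k} are conjugate in A_S but are not conjugate in the standard parabolic subgroup A_X generated by {σ_1,…,σ_{2k}}. In particular, A_X is not conjugacy stable in A_S. -/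
namespace ArtinTits

/-- The ordered product `σ_3 σ_4 ⋯ σ_{2k}` (paper's 1-based labelling, i.e. indices
`2, 3, …, 2k - 1` here) in the Artin–Tits group of type `D_{2k+1}`. -/
def tailD (k : ℕ) : ArtinGroup (Dmat (2 * k + 1)) :=
  ((((List.finRange (2 * k + 1)).filter fun i => decide (2 ≤ i.val ∧ i.val < 2 * k))).map
    (σ (Dmat (2 * k + 1)))).prod


/-! ### Relations in the Artin group of type D -/

/-- `ℕ`-indexed generators. -/
def natGen (n i : ℕ) : ArtinGroup (Dmat n) := if h : i < n then σ (Dmat n) ⟨i, h⟩ else 1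

theorem artin_rel {B : Type*} (M : CoxeterMatrix B) (s t : B) (h : M s t ≠ 0) :
    altProd (σ M s) (σ M t) (M s t) = altProd (σ M t) (σ M s) (M s t) := by
  have h1 : PresentedGroup.mk (artinRelationsSet M)
      (altProd (FreeGroup.of s) (FreeGroup.of t) (M s t) *
        (altProd (FreeGroup.of t) (FreeGroup.of s) (M s t))⁻¹) = 1 := by
    apply PresentedGroup.one_of_mem
    exact ⟨s, t, h, rfl⟩
  have key : ∀ (m : ℕ) (a b : FreeGroup B),
      PresentedGroup.mk (artinRelationsSet M) (altProd a b m) =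
        altProd (PresentedGroup.mk (artinRelationsSet M) a)
          (PresentedGroup.mk (artinRelationsSet M) b) m := by
    intro m
    induction m with
    | zero => intro a b; simp [altProd]
    | succ m ih => intro a b; simp [altProd, ih]
  rw [map_mul, map_inv, mul_inv_eq_one, key, key] at h1
  exact h1

theorem natGen_comm {n i j : ℕ} (hij : i + 2 ≤ j) (h : ¬ (i = 0 ∧ j = 2)) :
    natGen n i * natGen n j = natGen n j * natGen n i := by
  unfold natGen
  split_ifs with h1 h2
  · have hM : (Dmat n) ⟨i, h1⟩ ⟨j, h2⟩ = 2 := by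
      change (if _ then _ else _) = 2
      simp only [Fin.mk.injEq]
      split_ifs <;> omega
    have := artin_rel (Dmat n) ⟨i, h1⟩ ⟨j, h2⟩ (by rw [hM]; norm_num)
    rw [hM] at this
    simpa [altProd] using this
  all_goals simp

theorem natGen_comm01 {n : ℕ} :
    natGen n 0 * natGen n 1 = natGen n 1 * natGen n 0 := by
  unfold natGen
  split_ifs with h1 h2
  · have hM : (Dmat n) ⟨0, h1⟩ ⟨1, h2⟩ = 2 := by
      change (Dmat n).M _ _ = 2
      simp [Dmat]
    have := artin_rel (Dmat n) ⟨0, h1⟩ ⟨1, h2⟩ (by rw [hM]; norm_num)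
    rw [hM] at this
    simpa [altProd] using this
  all_goals simp

theorem natGen_braid {n i j : ℕ} (hj : j < n) (h : (i = 0 ∧ j = 2) ∨ (1 ≤ i ∧ j = i + 1)) :
    natGen n i * natGen n j * natGen n i = natGen n j * natGen n i * natGen n j := by
  have hi : i < n := by omega
  have hM : (Dmat n) ⟨i, hi⟩ ⟨j, hj⟩ = 3 := by
    change (if _ then _ else _) = 3
    simp only [Fin.mk.injEq]
    split_ifs <;> omega
  have := artin_rel (Dmat n) ⟨i, hi⟩ ⟨j, hj⟩ (by rw [hM]; norm_num)
  rw [hM] at this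
  simpa [altProd, natGen, hi, hj, mul_assoc] using this

/-- The element `σ_m ⋯ σ_3 σ_1 σ_2 σ_3 ⋯ σ_m`, where `m = j + 2`. -/
def rr (n : ℕ) : ℕ → ArtinGroup (Dmat n)
  | 0 => natGen n 0 * natGen n 1
  | j + 1 => natGen n (j + 2) * rr n j * natGen n (j + 2)

theorem rr_comm_far (n j : ℕ) : ∀ i, j + 3 ≤ i → Commute (natGen n i) (rr n j) := by
  induction j with
  | zero =>
    intro i hi
    exact Commute.mul_right (natGen_comm (by omega) (by omega)).symm
      (natGen_comm (by omega) (by omega)).symm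
  | succ j ih =>
    intro i hi
    have h : Commute (natGen n i) (natGen n (j + 2)) :=
      (natGen_comm (by omega) (by omega)).symm
    exact (h.mul_right (ih i (by omega))).mul_right h

theorem rr_swap (n j : ℕ) (hj : j + 3 ≤ n) :
    natGen n 0 * rr n (j + 1) = rr n (j + 1) * natGen n 1 := by
  induction j with
  | zero =>
    have h1 := natGen_braid (n := n) (i := 0) (j := 2) (by omega) (by omega)
    have h2 := natGen_braid (n := n) (i := 1) (j := 2) (by omega) (by omega)
    simp only [rr, zero_add]
    calc _ = (natGen n 0 * natGen n 2 * natGen n 0) * natGen n 1 * natGen n 2 := by group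
      _ = natGen n 2 * natGen n 0 * (natGen n 2 * natGen n 1 * natGen n 2) := by
        rw [h1]; group
      _ = _ := by rw [← h2]; group
  | succ j ih =>
    have ih := ih (by omega)
    have h0 : natGen n 0 * natGen n (j + 3) = natGen n (j + 3) * natGen n 0 :=
      natGen_comm (by omega) (by omega)
    have h1 : natGen n 1 * natGen n (j + 3) = natGen n (j + 3) * natGen n 1 :=
      natGen_comm (by omega) (by omega)
    rw [rr]
    change _ * (natGen n (j + 3) * _ * natGen n (j + 3)) =
      (natGen n (j + 3) * _ * natGen n (j + 3)) * _
    calc _ = (natGen n 0 * natGen n (j + 3)) * rr n (j + 1) * natGen n (j + 3) := by group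
      _ = natGen n (j + 3) * (natGen n 0 * rr n (j + 1)) * natGen n (j + 3) := by
        rw [h0]; group
      _ = natGen n (j + 3) * rr n (j + 1) * (natGen n 1 * natGen n (j + 3)) := by
        rw [ih]; group
      _ = _ := by rw [h1]; group

theorem rr_comm_near (n j : ℕ) (hj : j + 2 ≤ n) :
    ∀ i, 2 ≤ i → i < j + 1 → Commute (natGen n i) (rr n j) := by
  induction j with
  | zero => intro i h1 h2; omega
  | succ j ih =>
    intro i h1 h2
    by_cases hij : i < j + 1
    · have h : Commute (natGen n i) (natGen n (j + 2)) :=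
        natGen_comm (by omega) (by omega)
      exact (h.mul_right (ih (by omega) i h1 hij)).mul_right h
    · obtain ⟨l, rfl⟩ : ∃ l, j = l + 1 := ⟨j - 1, by omega⟩
      obtain rfl : i = l + 2 := by omega
      have hb := natGen_braid (n := n) (i := l + 2) (j := l + 3) (by omega) (by omega)
      have hc : natGen n (l + 3) * rr n l = rr n l * natGen n (l + 3) :=
        rr_comm_far n l (l + 3) (by omega)
      change natGen n (l + 2) * (natGen n (l + 3) * (natGen n (l + 2) * rr n l * natGen n (l + 2)) *
        natGen n (l + 3)) = (natGen n (l + 3) * (natGen n (l + 2) * rr n l * natGen n (l + 2)) *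
        natGen n (l + 3)) * natGen n (l + 2)
      calc _ = (natGen n (l + 2) * natGen n (l + 3) * natGen n (l + 2)) * rr n l *
            natGen n (l + 2) * natGen n (l + 3) := by group
        _ = natGen n (l + 3) * natGen n (l + 2) * (natGen n (l + 3) * rr n l) *
            natGen n (l + 2) * natGen n (l + 3) := by rw [hb]; group
        _ = natGen n (l + 3) * natGen n (l + 2) * rr n l *
            (natGen n (l + 3) * natGen n (l + 2) * natGen n (l + 3)) := by rw [hc]; group
        _ = _ := by rw [← hb]; group

theorem filter_range_eq (m : ℕ) : ∀ n, m + 2 ≤ n →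
    (List.range n).filter (fun i => decide (2 ≤ i ∧ i < m + 2)) = List.range' 2 m := by
  intro n hn
  obtain ⟨d, rfl⟩ := Nat.exists_eq_add_of_le hn
  rw [List.range_eq_range', show m + 2 + d = 2 + (m + d) by omega, ← List.range'_append_1,
    ← List.range'_append_1, List.filter_append, List.filter_append]
  rw [List.filter_eq_nil_iff.2, List.filter_eq_self.2, List.filter_eq_nil_iff.2]
  · simp
  all_goals
    intro a ha
    simp only [List.mem_range'_1] at ha
    simp
    omega

theorem tailD_eq (k : ℕ) (hk : 2 ≤ k) :
    tailD k = ((List.range' 2 (2 * k - 2)).map (natGen (2 * k + 1))).prod := by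
  rw [← filter_range_eq (2 * k - 2) (2 * k + 1) (by omega), ← List.map_coe_finRange_eq_range,
    List.filter_map, List.map_map]
  unfold tailD
  congr 1
  have : (fun i : Fin (2 * k + 1) => decide (2 ≤ i.val ∧ i.val < 2 * k)) =
    (fun i => decide (2 ≤ i ∧ i < 2 * k - 2 + 2)) ∘ Fin.val := by
    funext i
    simp only [Function.comp]
    congr 2
    rw [show 2 * k - 2 + 2 = 2 * k by omega]
  rw [this]
  apply List.map_congr_left
  intro i _
  rw [Function.comp_apply, natGen, dif_pos i.isLt]

theorem conj_in_A (k : ℕ) (hk : 2 ≤ k) :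
    (rr (2 * k + 1) (2 * k - 1))⁻¹ * (natGen (2 * k + 1) 0 * tailD k) *
      rr (2 * k + 1) (2 * k - 1) = natGen (2 * k + 1) 1 * tailD k := by
  have h1 : Commute (tailD k) (rr (2 * k + 1) (2 * k - 1)) := by
    rw [tailD_eq k hk]
    apply Commute.list_prod_left
    intro x hx
    obtain ⟨i, hi, rfl⟩ := List.mem_map.1 hx
    rw [List.mem_range'_1] at hi
    exact rr_comm_near _ _ (by omega) i (by omega) (by omega)
  have h2 := rr_swap (2 * k + 1) (2 * k - 2) (by omega)
  rw [show 2 * k - 2 + 1 = 2 * k - 1 by omega] at h2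
  rw [mul_assoc, mul_assoc, h1.eq, ← mul_assoc (natGen _ 0), h2]
  group

/-! ### Signed permutations -/

/-- Signed permutations of `ℕ`. -/
abbrev SP := (ℕ → ℤˣ) ⋊[mulAutArrow] (Equiv.Perm ℕ)

/-- Sign change at `0`. -/
def dfun : ℕ → ℤˣ := fun i => if i = 0 then -1 else 1

/-- Sign change at `0`, as a signed permutation. -/
def dd : SP := SemidirectProduct.inl dfun

/-- Unsigned permutations. -/
def pp (e : Equiv.Perm ℕ) : SP := SemidirectProduct.inr e

/-- Images of the standard generators. -/
def sgen (i : ℕ) : SP :=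
  if i = 0 then pp (Equiv.swap 0 1) else
  if i = 1 then dd * pp (Equiv.swap 0 1) * dd else pp (Equiv.swap (i - 1) i)

theorem smul_arrow (e : Equiv.Perm ℕ) (f : ℕ → ℤˣ) (i : ℕ) :
    (mulAutArrow e f : ℕ → ℤˣ) i = f (e⁻¹ i) := rfl

theorem dd_mul_dd : dd * dd = 1 := by
  unfold dd
  rw [← map_mul]
  have : dfun * dfun = 1 := by
    funext i; simp only [dfun, Pi.mul_apply]; split_ifs <;> simp
  rw [this, map_one]

theorem dd_comm (e : Equiv.Perm ℕ) (he : e 0 = 0) : Commute dd (pp e) := by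
  have h0 : e⁻¹ 0 = 0 := by rw [Equiv.Perm.inv_eq_iff_eq, he]
  apply SemidirectProduct.ext
  · funext i
    simp only [dd, pp, SemidirectProduct.mul_left, SemidirectProduct.left_inl,
      SemidirectProduct.right_inl, SemidirectProduct.left_inr, SemidirectProduct.right_inr,
      Pi.mul_apply, smul_arrow, dfun, map_one, Pi.one_apply, one_mul, mul_one]
    have : e⁻¹ i = 0 ↔ i = 0 := by
      rw [Equiv.Perm.inv_eq_iff_eq, he]
    simp only [this]
  · simp [dd, pp]

theorem sgen_comm01 : sgen 0 * sgen 1 = sgen 1 * sgen 0 := by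
  apply SemidirectProduct.ext
  · funext i
    simp only [sgen, dd, pp, SemidirectProduct.mul_left, SemidirectProduct.left_inl,
      SemidirectProduct.right_inl, SemidirectProduct.left_inr, SemidirectProduct.right_inr,
      SemidirectProduct.mul_right, if_true, one_ne_zero, if_false,
      Pi.mul_apply, smul_arrow, dfun, map_one, Pi.one_apply, one_mul, mul_one, Equiv.swap_inv,
      map_mul, Equiv.swap_apply_def, SemidirectProduct.mul_left]
    rcases i with _ | _ | i <;> simp
  · simp [sgen, dd, pp]

theorem swap_comm {a b c d : ℕ} (h1 : a ≠ c) (h2 : a ≠ d) (h3 : b ≠ c) (h4 : b ≠ d) :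
    Equiv.swap a b * Equiv.swap c d = Equiv.swap c d * Equiv.swap a b := by
  ext x
  simp only [Equiv.Perm.mul_apply, Equiv.swap_apply_def]
  grind

theorem swap_braid {a b c : ℕ} (h1 : a ≠ b) (h2 : b ≠ c) (h3 : a ≠ c) :
    Equiv.swap a b * Equiv.swap b c * Equiv.swap a b =
      Equiv.swap b c * Equiv.swap a b * Equiv.swap b c := by
  ext x
  simp only [Equiv.Perm.mul_apply, Equiv.swap_apply_def]
  grind

theorem sgen_comm {i j : ℕ} (hij : i + 2 ≤ j) (h : ¬ (i = 0 ∧ j = 2)) :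
    sgen i * sgen j = sgen j * sgen i := by
  have hj : sgen j = pp (Equiv.swap (j - 1) j) := by
    unfold sgen; rw [if_neg (by omega), if_neg (by omega)]
  have key : ∀ a b, a + 1 < j → b + 1 < j →
      Commute (pp (Equiv.swap a b)) (pp (Equiv.swap (j - 1) j)) := by
    intro a b ha hb
    change _ * _ = _ * _
    unfold pp
    rw [← map_mul, ← map_mul, swap_comm (by omega) (by omega) (by omega) (by omega)]
  rw [hj]
  change Commute _ _
  unfold sgen
  split_ifs with h1 h2
  · exact key 0 1 (by omega) (by omega)
  · have hd := dd_comm (Equiv.swap (j - 1) j) (Equiv.swap_apply_of_ne_of_ne (by omega) (by omega))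
    exact (hd.mul_left (key 0 1 (by omega) (by omega))).mul_left hd
  · exact key _ _ (by omega) (by omega)

theorem pp_braid {a b c : ℕ} (h1 : a ≠ b) (h2 : b ≠ c) (h3 : a ≠ c) :
    pp (Equiv.swap a b) * pp (Equiv.swap b c) * pp (Equiv.swap a b) =
      pp (Equiv.swap b c) * pp (Equiv.swap a b) * pp (Equiv.swap b c) := by
  unfold pp
  simp only [← map_mul]
  rw [swap_braid h1 h2 h3]

theorem sgen_braid {i j : ℕ} (h : (i = 0 ∧ j = 2) ∨ (1 ≤ i ∧ j = i + 1)) :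
    sgen i * sgen j * sgen i = sgen j * sgen i * sgen j := by
  have hj : sgen j = pp (Equiv.swap (j - 1) j) := by
    unfold sgen; rw [if_neg (by omega), if_neg (by omega)]
  rw [hj]
  unfold sgen
  split_ifs with h1 h2
  · obtain rfl : j = 2 := by omega
    exact pp_braid (by omega) (by omega) (by omega)
  · obtain rfl : j = 2 := by omega
    have hd : dd * pp (Equiv.swap 1 2) = pp (Equiv.swap 1 2) * dd :=
      dd_comm (Equiv.swap 1 2) (Equiv.swap_apply_of_ne_of_ne (by omega) (by omega))
    have hb : pp (Equiv.swap 0 1) * pp (Equiv.swap 1 2) * pp (Equiv.swap 0 1) =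
      pp (Equiv.swap 1 2) * pp (Equiv.swap 0 1) * pp (Equiv.swap 1 2) :=
      pp_braid (by omega) (by omega) (by omega)
    simp only [Nat.add_one_sub_one]
    generalize pp (Equiv.swap 0 1) = x at *
    generalize pp (Equiv.swap 1 2) = y at *
    calc dd * x * dd * y * (dd * x * dd) = dd * x * (dd * y) * dd * x * dd := by group
      _ = dd * x * y * (dd * dd) * x * dd := by rw [hd]; group
      _ = dd * (x * y * x) * dd := by rw [dd_mul_dd]; group
      _ = (dd * y) * x * (y * dd) := by rw [hb]; group
      _ = (y * dd) * x * (dd * y) := by rw [hd]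
      _ = _ := by group
  · obtain rfl : j = i + 1 := by omega
    exact pp_braid (by omega) (by omega) (by omega)

theorem map_altProd {G H : Type*} [Group G] [Group H] (f : G →* H) (m : ℕ) :
    ∀ a b : G, f (altProd a b m) = altProd (f a) (f b) m := by
  induction m with
  | zero => intro a b; simp [altProd]
  | succ m ih => intro a b; simp [altProd, ih]

theorem sgen_rel (n : ℕ) (i j : Fin n) (hij : i.val ≤ j.val) :
    altProd (sgen i) (sgen j) ((Dmat n) i j) = altProd (sgen j) (sgen i) ((Dmat n) i j) := by
  by_cases h : i = j
  · rw [h]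
  have hne : i.val ≠ j.val := fun h' => h (Fin.ext h')
  by_cases h3 : (i.val = 0 ∧ j.val = 2) ∨ (1 ≤ i.val ∧ j.val = i.val + 1)
  · have hM : (Dmat n) i j = 3 := by
      change (if _ then _ else _) = 3
      rw [if_neg h]
      split_ifs <;> omega
    rw [hM]
    simpa [altProd, mul_assoc] using sgen_braid h3
  · have hM : (Dmat n) i j = 2 := by
      change (if _ then _ else _) = 2
      rw [if_neg h]
      split_ifs <;> omega
    rw [hM]
    have : sgen i * sgen j = sgen j * sgen i := by
      by_cases h01 : i.val = 0 ∧ j.val = 1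
      · rw [h01.1, h01.2]; exact sgen_comm01
      · exact sgen_comm (by omega) (by omega)
    simpa [altProd] using this

/-- The homomorphism to signed permutations. -/
def toSP (n : ℕ) : ArtinGroup (Dmat n) →* SP :=
  PresentedGroup.toGroup (f := fun i : Fin n => sgen i.val) (by
    rintro r ⟨s, t, _, rfl⟩
    rw [map_mul, map_inv, mul_inv_eq_one, map_altProd, map_altProd, FreeGroup.lift_apply_of,
      FreeGroup.lift_apply_of]
    rcases le_total s.val t.val with h | h
    · exact sgen_rel n s t h
    · rw [(Dmat n).symmetric s t]
      exact (sgen_rel n t s h).symm)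

theorem toSP_σ (n : ℕ) (i : Fin n) : toSP n (σ (Dmat n) i) = sgen i.val :=
  PresentedGroup.toGroup.of _

theorem toSP_natGen (n i : ℕ) (h : i < n) : toSP n (natGen n i) = sgen i := by
  rw [natGen, dif_pos h, toSP_σ]

/-- The signed permutations in the image of `A_X`. -/
def good (m : ℕ) (x : SP) : Prop :=
  (∀ i, m ≤ i → x.right i = i) ∧ ∏ i ∈ Finset.range m, x.left i = 1

theorem prod_perm (m : ℕ) (e : Equiv.Perm ℕ) (he : ∀ i, m ≤ i → e i = i) (f : ℕ → ℤˣ) :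
    ∏ i ∈ Finset.range m, f (e i) = ∏ i ∈ Finset.range m, f i := by
  apply Equiv.Perm.prod_comp
  intro a ha
  simp only [Set.mem_ofPred_eq] at ha
  simp only [Finset.coe_range, Set.mem_Iio]
  by_contra h
  exact ha (he a (by omega))

theorem perm_inv_fix (m : ℕ) (e : Equiv.Perm ℕ) (he : ∀ i, m ≤ i → e i = i) :
    ∀ i, m ≤ i → e⁻¹ i = i := by
  intro i hi
  rw [Equiv.Perm.inv_eq_iff_eq, he i hi]

theorem prod_mul_left (m : ℕ) (x y : SP) (hx : ∀ i, m ≤ i → x.right i = i) :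
    ∏ i ∈ Finset.range m, (x * y).left i =
      (∏ i ∈ Finset.range m, x.left i) * ∏ i ∈ Finset.range m, y.left i := by
  simp only [SemidirectProduct.mul_left, Pi.mul_apply, smul_arrow, Finset.prod_mul_distrib]
  rw [prod_perm m _ (perm_inv_fix m _ hx)]

theorem good_mul {m : ℕ} {x y : SP} (hx : good m x) (hy : good m y) : good m (x * y) := by
  refine ⟨?_, ?_⟩
  · intro i hi
    rw [SemidirectProduct.mul_right, Equiv.Perm.mul_apply, hy.1 i hi, hx.1 i hi]
  · rw [prod_mul_left m x y hx.1, hx.2, hy.2, one_mul]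

theorem good_one (m : ℕ) : good m 1 := by
  refine ⟨?_, ?_⟩ <;> simp

theorem good_inv {m : ℕ} {x : SP} (hx : good m x) : good m x⁻¹ := by
  refine ⟨?_, ?_⟩
  · rw [SemidirectProduct.inv_right]; exact perm_inv_fix m _ hx.1
  · have := prod_mul_left m x x⁻¹ hx.1
    rw [hx.2, one_mul, mul_inv_cancel] at this
    rw [← this]; simp

theorem prod_dfun (m : ℕ) (hm : 0 < m) : ∏ i ∈ Finset.range m, dfun i = -1 := by
  unfold dfun
  rw [Finset.prod_ite_eq' (Finset.range m) 0 (fun _ => (-1 : ℤˣ))]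
  simp [hm]

theorem good_sgen (m i : ℕ) (hm : 2 ≤ m) (hi : i < m) : good m (sgen i) := by
  have hp : ∀ a b, a < m → b < m → good m (pp (Equiv.swap a b)) := by
    intro a b ha hb
    refine ⟨fun i hi => ?_, ?_⟩
    · exact Equiv.swap_apply_of_ne_of_ne (by omega) (by omega)
    · simp [pp]
  unfold sgen
  split_ifs
  · exact hp _ _ (by omega) (by omega)
  · have h0 := hp 0 1 (by omega) (by omega)
    refine ⟨?_, ?_⟩
    · intro i hi
      simpa [dd] using h0.1 i hi
    · rw [mul_assoc, prod_mul_left _ _ _ (by intro i _; simp [dd]), prod_mul_left _ _ _ h0.1, h0.2]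
      simp [dd, prod_dfun m (by omega)]
  · exact hp _ _ (by omega) (by omega)

theorem good_AP (n m : ℕ) (hm : 2 ≤ m) (c : ArtinGroup (Dmat n))
    (hc : c ∈ AP (Dmat n) {i : Fin n | i.val < m}) : good m (toSP n c) := by
  unfold AP at hc
  induction hc using Subgroup.closure_induction with
  | mem x hx =>
    obtain ⟨i, hi, rfl⟩ := hx
    rw [toSP_σ]
    exact good_sgen m i hm hi
  | one => rw [map_one]; exact good_one m
  | mul x y _ _ hx hy => rw [map_mul]; exact good_mul hx hy
  | inv x _ hx => rw [map_inv]; exact good_inv hx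

/-- The cycle `swap 1 2 * ... * swap m (m+1)`. -/
def tailPerm (m : ℕ) : Equiv.Perm ℕ :=
  ((List.range' 2 m).map fun i => Equiv.swap (i - 1) i).prod

theorem tailPerm_succ (m : ℕ) :
    tailPerm (m + 1) = tailPerm m * Equiv.swap (m + 1) (m + 2) := by
  unfold tailPerm
  rw [List.range'_1_concat]
  simp [show 2 + m - 1 = m + 1 by omega, show 2 + m = m + 2 by omega]

theorem tailPerm_apply (m : ℕ) :
    (∀ i, 1 ≤ i → i < m + 1 → tailPerm m i = i + 1) ∧ (∀ i, m + 1 < i → tailPerm m i = i) ∧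
      tailPerm m 0 = 0 ∧ tailPerm m (m + 1) = 1 := by
  induction m with
  | zero =>
    refine ⟨fun i h1 h2 => by omega, ?_, ?_, ?_⟩ <;> simp [tailPerm]
  | succ m ih =>
    obtain ⟨h1, h2, h3, h4⟩ := ih
    rw [tailPerm_succ]
    refine ⟨?_, ?_, ?_, ?_⟩
    · intro i hi hi'
      rw [Equiv.Perm.mul_apply]
      by_cases h : i = m + 1
      · subst h
        rw [Equiv.swap_apply_left, h2 _ (by omega)]
      · rw [Equiv.swap_apply_of_ne_of_ne (by omega) (by omega), h1 i hi (by omega)]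
    · intro i hi
      rw [Equiv.Perm.mul_apply, Equiv.swap_apply_of_ne_of_ne (by omega) (by omega),
        h2 i (by omega)]
    · rw [Equiv.Perm.mul_apply, Equiv.swap_apply_of_ne_of_ne (by omega) (by omega), h3]
    · rw [Equiv.Perm.mul_apply, show m + 1 + 1 = m + 2 by omega, Equiv.swap_apply_right, h4]

theorem toSP_tailD (k : ℕ) (hk : 2 ≤ k) :
    toSP (2 * k + 1) (tailD k) = pp (tailPerm (2 * k - 2)) := by
  rw [tailD_eq k hk, map_list_prod]
  unfold tailPerm pp
  rw [map_list_prod, List.map_map, List.map_map]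
  congr 1
  apply List.map_congr_left
  intro i hi
  rw [List.mem_range'_1] at hi
  simp only [Function.comp]
  rw [toSP_natGen _ _ (by omega)]
  unfold sgen
  rw [if_neg (by omega), if_neg (by omega)]
  rfl

theorem not_conj (k : ℕ) (hk : 2 ≤ k) (c : ArtinGroup (Dmat (2 * k + 1)))
    (hc : c ∈ AP (Dmat (2 * k + 1)) {i : Fin (2 * k + 1) | i.val < 2 * k})
    (h : c⁻¹ * (natGen (2 * k + 1) 0 * tailD k) * c = natGen (2 * k + 1) 1 * tailD k) :
    False := by
  have hg := good_AP (2 * k + 1) (2 * k) (by omega) c hc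
  have hS := congrArg (toSP (2 * k + 1)) h
  simp only [map_mul, map_inv] at hS
  rw [toSP_natGen _ _ (by omega), toSP_natGen _ _ (by omega), toSP_tailD k hk] at hS
  generalize toSP (2 * k + 1) c = x at hg hS
  obtain ⟨t1, t2, t3, t4⟩ := tailPerm_apply (2 * k - 2)
  generalize tailPerm (2 * k - 2) = τ at *
  have hd : dd * pp τ = pp τ * dd := dd_comm τ t3
  simp only [sgen, if_true, one_ne_zero, if_false] at hS
  have hcomm : pp (Equiv.swap 0 1 * τ) * (x * dd) = (x * dd) * pp (Equiv.swap 0 1 * τ) := by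
    have e : pp (Equiv.swap 0 1 * τ) = pp (Equiv.swap 0 1) * pp τ := map_mul _ _ _
    rw [e]
    generalize pp (Equiv.swap 0 1) = u at *
    generalize pp τ = v at *
    have hS' : u * v * x = x * (dd * u * dd * v) := by rw [← hS]; group
    calc u * v * (x * dd) = (u * v * x) * dd := by group
      _ = x * dd * u * (dd * v) * dd := by rw [hS']; group
      _ = x * dd * u * v * (dd * dd) := by rw [hd]; group
      _ = _ := by rw [dd_mul_dd]; group
  set γ := Equiv.swap 0 1 * τ with hγ
  have hstep : ∀ i, i + 1 < 2 * k → γ i = i + 1 := by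
    intro i hi
    rw [hγ, Equiv.Perm.mul_apply]
    rcases Nat.eq_zero_or_pos i with rfl | hp
    · rw [t3, Equiv.swap_apply_left]
    · rw [t1 i hp (by omega), Equiv.swap_apply_of_ne_of_ne (by omega) (by omega)]
  have hf : ∀ i, (x * dd).left (γ i) = (x * dd).left i := by
    intro i
    have := congrFun (congrArg SemidirectProduct.left hcomm) (γ i)
    rw [SemidirectProduct.mul_left, SemidirectProduct.mul_left (x * dd)] at this
    simp only [pp, SemidirectProduct.left_inr, SemidirectProduct.right_inr, Pi.mul_apply,
      smul_arrow, map_one, Pi.one_apply, one_mul, mul_one] at this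
    rw [show γ⁻¹ (γ i) = i from γ.symm_apply_apply i] at this
    exact this.symm
  have hconst : ∀ i, i < 2 * k → (x * dd).left i = (x * dd).left 0 := by
    intro i
    induction i with
    | zero => intro _; rfl
    | succ i ih =>
      intro hi
      rw [← ih (by omega), ← hf i, hstep i hi]
  have hp1 : ∏ i ∈ Finset.range (2 * k), (x * dd).left i = -1 := by
    rw [prod_mul_left _ _ _ hg.1, hg.2, one_mul]
    exact prod_dfun _ (by omega)
  have hp2 : ∏ i ∈ Finset.range (2 * k), (x * dd).left i = 1 := by
    rw [Finset.prod_congr rfl (fun i hi => hconst i (Finset.mem_range.1 hi)),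
      Finset.prod_const, Finset.card_range, pow_mul, Int.units_sq, one_pow]
  rw [hp1] at hp2
  exact absurd hp2 (by decide)

theorem natGen_mem (n m i : ℕ) (hi : i < m) (hn : i < n) :
    natGen n i ∈ AP (Dmat n) {i : Fin n | i.val < m} := by
  rw [natGen, dif_pos hn]
  exact Subgroup.subset_closure ⟨_, hi, rfl⟩

theorem tailD_mem (k : ℕ) (hk : 2 ≤ k) :
    tailD k ∈ AP (Dmat (2 * k + 1)) {i : Fin (2 * k + 1) | i.val < 2 * k} := by
  rw [tailD_eq k hk]
  apply Subgroup.list_prod_mem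
  intro x hx
  obtain ⟨i, hi, rfl⟩ := List.mem_map.1 hx
  rw [List.mem_range'_1] at hi
  exact natGen_mem _ _ i (by omega) (by omega)

/-- Counterexample (d) of the paper: in the Artin–Tits group of type `D_{2k+1}` (vertices
`0,…,2k` standing for `s_1,…,s_{2k+1}`), the elements `g = σ_1 σ_3 σ_4 ⋯ σ_{2k}` and
`h = σ_2 σ_3 σ_4 ⋯ σ_{2k}` of the standard parabolic subgroup of type `D_{2k}` on
`{s_1,…,s_{2k}}` are conjugate in `A_S` but not in `A_X`; in particular `A_X` is not conjugacy
stable in `A_S`. -/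
theorem D2k_not_conjugacy_stable (k : ℕ) (hk : 2 ≤ k) :
    (∃ c : ArtinGroup (Dmat (2 * k + 1)),
        c⁻¹ * (σ (Dmat (2 * k + 1)) ⟨0, by omega⟩ * tailD k) * c =
          σ (Dmat (2 * k + 1)) ⟨1, by omega⟩ * tailD k) ∧
    (¬ ∃ c ∈ AP (Dmat (2 * k + 1)) {i : Fin (2 * k + 1) | i.val < 2 * k},
        c⁻¹ * (σ (Dmat (2 * k + 1)) ⟨0, by omega⟩ * tailD k) * c =
          σ (Dmat (2 * k + 1)) ⟨1, by omega⟩ * tailD k) ∧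
    ¬ IsConjugacyStable (AP (Dmat (2 * k + 1)) {i : Fin (2 * k + 1) | i.val < 2 * k}) := by
  have hlt0 : 0 < 2 * k + 1 := by omega
  have hlt1 : 1 < 2 * k + 1 := by omega
  have e0 : natGen (2 * k + 1) 0 = σ (Dmat (2 * k + 1)) ⟨0, hlt0⟩ := dif_pos hlt0
  have e1 : natGen (2 * k + 1) 1 = σ (Dmat (2 * k + 1)) ⟨1, hlt1⟩ := dif_pos hlt1
  rw [← e0, ← e1]
  refine ⟨⟨_, conj_in_A k hk⟩, ?_, ?_⟩
  · rintro ⟨c, hc, h⟩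
    exact not_conj k hk c hc h
  · intro hst
    obtain ⟨c, hc, h⟩ := hst _ _
      (Subgroup.mul_mem _ (natGen_mem _ _ 0 (by omega) (by omega)) (tailD_mem k hk))
      (Subgroup.mul_mem _ (natGen_mem _ _ 1 (by omega) (by omega)) (tailD_mem k hk))
      ⟨_, conj_in_A k hk⟩
    exact not_conj k hk c hc h

end ArtinTits
end
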